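/- arXiv:2306.13828 — 8 statements merged into one kernel-verified Lean document; each statement's English description precedes it below -/
import Mathlib

section
/- Let n ≥ 1, let A ∈ ℝ^{n×n} be the single nilpotent Jordan block with eigenvalue 0 (A_{i,i+1} = 1 for 1 ≤ i ≤ n−1, all other entries 0), C = (1,0,…,0) ∈ ℝ^{1×n}, h̄ ≥ 0, and L ∈ ℝⁿ. For λ > 0 define the functional ψ_{λ,h̄}^L : C([−h̄,0],ℝⁿ) → ℝⁿ by ψ_{λ,h̄}^L(φ) = A·φ(0) − Λ_λ^r(L·(Cφ(−h̄))), with weights r = [1,…,n]. Then for every continuous φ : [−h̄,0] → ℝⁿ and every λ > 0, ψ_{λ,h̄}^L(Λ_λ^r ∘ φ) = λ·Λ_λ^r(ψ_{1,h̄}^L(φ)). -/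
/-- The functional vector field
`ψ_{λ,h̄}^L(φ) = A φ(0) − Λ_λ^r(L·(Cφ(−h̄)))` satisfies the homogeneity-type identity
`ψ_{λ,h̄}^L(Λ_λ^r ∘ φ) = λ · Λ_λ^r(ψ_{1,h̄}^L(φ))` for every continuous
`φ : [−h̄,0] → ℝⁿ` and every `λ > 0`. -/
theorem psi_pseudo_homogeneous
    (n : ℕ) (hn : 1 ≤ n)
    (A : Matrix (Fin n) (Fin n) ℝ)
    (hA : ∀ i j : Fin n, A i j = if (j : ℕ) = (i : ℕ) + 1 then 1 else 0)
    (L : Fin n → ℝ) (hbar : ℝ) (hhbar : 0 ≤ hbar)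
    (Λ : ℝ → (Fin n → ℝ) → (Fin n → ℝ))
    (hΛ : ∀ (lam : ℝ) (x : Fin n → ℝ) (i : Fin n), Λ lam x i = lam ^ ((i : ℕ) + 1) * x i)
    (ψ : ℝ → (ℝ → Fin n → ℝ) → (Fin n → ℝ))
    (hψ : ∀ (lam : ℝ) (φ : ℝ → Fin n → ℝ),
      ψ lam φ = A.mulVec (φ 0) - Λ lam (fun i => L i * φ (-hbar) ⟨0, hn⟩))
    (φ : ℝ → Fin n → ℝ) (hφ : ContinuousOn φ (Set.Icc (-hbar) 0))
    (lam : ℝ) (hlam : 0 < lam) :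
    ψ lam (fun θ => Λ lam (φ θ)) = lam • Λ lam (ψ 1 φ) := by
  have mulVec_dilation (x : Fin n → ℝ) (i : Fin n) :
      A.mulVec (Λ lam x) i = lam * (lam ^ ((i : ℕ) + 1) * A.mulVec x i) := by
    simp only [Matrix.mulVec, dotProduct, Finset.mul_sum]
    refine Finset.sum_congr rfl fun j _ => ?_
    rw [hA, hΛ]
    split_ifs with h
    · rw [h]
      ring
    · simp
  funext i
  simp only [hψ, Pi.sub_apply, Pi.smul_apply, smul_eq_mul, mulVec_dilation, hΛ]
  ring
end

section
/- Let n ≥ 1, let A ∈ ℝ^{n×n} be the single nilpotent Jordan block with eigenvalue 0, C = (1,0,…,0) ∈ ℝ^{1×n}, h̄ ≥ 0, λ > 0, L ∈ ℝⁿ, U a nonempty set, and φ : ℝⁿ × U → ℝⁿ. Let x : ℝ → ℝⁿ and v : ℝ → U be arbitrary functions, and suppose e : ℝ → ℝⁿ is differentiable and satisfies, for all t ∈ ℝ, ė(t) = A·e(t) − Λ_λ^r(L·(Ce(t−h̄))) + Δφ(e(t), x(t), v(t)), with weights r = [1,…,n]. Then the dilated error ε(τ) := Λ_{λ^{-1}}^r(e(τ/λ))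 is differentiable and satisfies, for all τ ∈ ℝ, dε(τ)/dτ = A·ε(τ) − L·(Cε(τ−λh̄)) + λ^{-1}·Λ_{λ^{-1}}^r(Δφ(Λ_λ^r(ε(τ)), x(τ/λ), v(τ/λ))). -/
/-- The nilpotent shift intertwines the weights `i + 1` and `i + 2` of the dilation. -/
lemma nilpotentShift_mulVec_weighted {n : ℕ} {A : Matrix (Fin n) (Fin n) ℝ}
    (hA : ∀ i j : Fin n, A i j = if (j : ℕ) = (i : ℕ) + 1 then 1 else 0)
    (μ : ℝ) (y z : Fin n → ℝ) (hz : ∀ j, z j = μ ^ ((j : ℕ) + 1) * y j) (i : Fin n) :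
    A.mulVec z i = μ ^ ((i : ℕ) + 2) * A.mulVec y i := by
  simp only [Matrix.mulVec, dotProduct, Finset.mul_sum, hA, hz]
  refine Finset.sum_congr rfl fun j _ => ?_
  split_ifs with h
  · rw [h]; ring
  · simp


/-- If the prediction error `e` satisfies
`ė(t) = A e(t) − Λ_λ^r(L·(Ce(t−h̄))) + Δφ(e(t),x(t),v(t))`, then the dilated error
`ε(τ) = Λ_{λ⁻¹}^r(e(τ/λ))` satisfies
`ε'(τ) = A ε(τ) − L·(Cε(τ−λh̄)) + λ⁻¹ Λ_{λ⁻¹}^r(Δφ(Λ_λ^r(ε(τ)), x(τ/λ), v(τ/λ)))`,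
where `Δφ(e,x,u) = φ(x+e,u) − φ(x,u)` and the weights are `r = [1,…,n]`. -/
theorem dilated_error_dynamics_predictor
    (n : ℕ) (hn : 1 ≤ n) {U : Type*} [Nonempty U]
    (A : Matrix (Fin n) (Fin n) ℝ)
    (hA : ∀ i j : Fin n, A i j = if (j : ℕ) = (i : ℕ) + 1 then 1 else 0)
    (L : Fin n → ℝ) (hbar : ℝ) (hhbar : 0 ≤ hbar)
    (lam : ℝ) (hlam : 0 < lam)
    (Λ : ℝ → (Fin n → ℝ) → (Fin n → ℝ))
    (hΛ : ∀ (μ : ℝ) (x : Fin n → ℝ) (i : Fin n), Λ μ x i = μ ^ ((i : ℕ) + 1) * x i)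
    (φ : (Fin n → ℝ) → U → (Fin n → ℝ))
    (x : ℝ → Fin n → ℝ) (v : ℝ → U)
    (e : ℝ → Fin n → ℝ)
    (he : ∀ t : ℝ, HasDerivAt e
      (A.mulVec (e t) - Λ lam (fun i => L i * e (t - hbar) ⟨0, hn⟩)
        + (φ (x t + e t) (v t) - φ (x t) (v t))) t) :
    ∀ τ : ℝ, HasDerivAt (fun s : ℝ => Λ lam⁻¹ (e (s / lam)))
      (A.mulVec (Λ lam⁻¹ (e (τ / lam)))
        - (fun i => L i * Λ lam⁻¹ (e ((τ - lam * hbar) / lam)) ⟨0, hn⟩)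
        + lam⁻¹ • Λ lam⁻¹
            (φ (x (τ / lam) + Λ lam (Λ lam⁻¹ (e (τ / lam)))) (v (τ / lam))
              - φ (x (τ / lam)) (v (τ / lam)))) τ := by
  intro τ
  have hne : lam ≠ 0 := hlam.ne'
  have hcancel : ∀ y, Λ lam (Λ lam⁻¹ y) = y := fun y => by
    ext i
    rw [hΛ, hΛ, ← mul_assoc, ← mul_pow, mul_inv_cancel₀ hne, one_pow, one_mul]
  have hdelay : (τ - lam * hbar) / lam = τ / lam - hbar := by field_simp
  rw [hcancel, hdelay, hasDerivAt_pi]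
  intro i
  have hscale : HasDerivAt (fun s : ℝ => s / lam) lam⁻¹ τ := by
    simpa using (hasDerivAt_id τ).div_const lam
  have hcomp := (((hasDerivAt_pi.1 (he (τ / lam))) i).comp τ hscale).const_mul
    (lam⁻¹ ^ ((i : ℕ) + 1))
  simp only [hΛ]
  refine hcomp.congr_deriv ?_
  simp only [Pi.add_apply, Pi.sub_apply, Pi.smul_apply, smul_eq_mul, hΛ,
    nilpotentShift_mulVec_weighted hA lam⁻¹ (e (τ / lam)) _ (hΛ _ _)]
  have hpow : lam⁻¹ ^ ((i : ℕ) + 1) * lam ^ ((i : ℕ) + 1) = 1 := by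
    rw [← mul_pow, inv_mul_cancel₀ hne, one_pow]
  linear_combination (-(L i * e (τ / lam - hbar) ⟨0, hn⟩ * lam⁻¹)) * hpow
end

section
/- Let n ≥ 1, let A ∈ ℝ^{n×n} be the single nilpotent Jordan block with eigenvalue 0, C = (1,0,…,0) ∈ ℝ^{1×n}, λ > 0, L ∈ ℝⁿ, U a nonempty set, and φ : ℝⁿ × U → ℝⁿ. Let x̂ : ℝ → ℝⁿ and v : ℝ → U be arbitrary functions, and suppose the observation error e : ℝ → ℝⁿ is differentiable and satisfies, for all t ∈ ℝ, ė(t) = A·e(t) − Λ_λ^r(L·(Ce(t))) + Δφ(e(t), x̂(t), v(t)), with weights r = [1,…,n]. Then the dilated error ε(τ) := Λ_{λ^{-1}}^r(e(τ/λ)) is differentiable and satisfies, for all τ ∈ ℝ, dε(τ)/dτ = (A − LC)·ε(τ) + λ^{-1}·Λ_{λ^{-1}}^r(Δφ(Λ_λ^r(ε(τ)), x̂(τ/λ), v(τ/λ))), i.e. the delay-free linear part is (A − LC) and the nonlinearity is scaled by λ^{-1}. -/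
/-- If the observation error `e` satisfies
`ė(t) = A e(t) − Λ_λ^r(L·(Ce(t))) + Δφ(e(t),x̂(t),v(t))` (no delay), then the dilated
error `ε(τ) = Λ_{λ⁻¹}^r(e(τ/λ))` satisfies
`ε'(τ) = (A − LC) ε(τ) + λ⁻¹ Λ_{λ⁻¹}^r(Δφ(Λ_λ^r(ε(τ)), x̂(τ/λ), v(τ/λ)))`,
where `Δφ(e,x,u) = φ(x+e,u) − φ(x,u)`, `LC` is the matrix whose first column is `L` and
whose other columns are zero, and the weights are `r = [1,…,n]`. -/
theorem dilated_error_dynamics_observer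
    (n : ℕ) (hn : 1 ≤ n) {U : Type*} [Nonempty U]
    (A : Matrix (Fin n) (Fin n) ℝ)
    (hA : ∀ i j : Fin n, A i j = if (j : ℕ) = (i : ℕ) + 1 then 1 else 0)
    (L : Fin n → ℝ)
    (LC : Matrix (Fin n) (Fin n) ℝ)
    (hLC : ∀ i j : Fin n, LC i j = if (j : ℕ) = 0 then L i else 0)
    (lam : ℝ) (hlam : 0 < lam)
    (Λ : ℝ → (Fin n → ℝ) → (Fin n → ℝ))
    (hΛ : ∀ (μ : ℝ) (x : Fin n → ℝ) (i : Fin n), Λ μ x i = μ ^ ((i : ℕ) + 1) * x i)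
    (φ : (Fin n → ℝ) → U → (Fin n → ℝ))
    (xhat : ℝ → Fin n → ℝ) (v : ℝ → U)
    (e : ℝ → Fin n → ℝ)
    (he : ∀ t : ℝ, HasDerivAt e
      (A.mulVec (e t) - Λ lam (fun i => L i * e t ⟨0, hn⟩)
        + (φ (xhat t + e t) (v t) - φ (xhat t) (v t))) t) :
    ∀ τ : ℝ, HasDerivAt (fun s : ℝ => Λ lam⁻¹ (e (s / lam)))
      ((A - LC).mulVec (Λ lam⁻¹ (e (τ / lam)))
        + lam⁻¹ • Λ lam⁻¹
            (φ (xhat (τ / lam) + Λ lam (Λ lam⁻¹ (e (τ / lam)))) (v (τ / lam))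
              - φ (xhat (τ / lam)) (v (τ / lam)))) τ := by
  have hΛinv : ∀ x, Λ lam (Λ lam⁻¹ x) = x := fun x => by
    ext i
    rw [hΛ, hΛ, ← mul_assoc, ← mul_pow, mul_inv_cancel₀ hlam.ne', one_pow, one_mul]
  have hAΛ : ∀ x i, A.mulVec (Λ lam⁻¹ x) i = lam⁻¹ * (lam⁻¹ ^ ((i : ℕ) + 1) * A.mulVec x i) :=
    fun x i => by
      simp only [Matrix.mulVec, dotProduct, Finset.mul_sum]
      refine Finset.sum_congr rfl fun j _ => ?_
      rw [hΛ, hA]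
      split_ifs with h
      · rw [h]
        ring
      · ring
  have hLCx : ∀ x i, LC.mulVec x i = L i * x ⟨0, hn⟩ := fun x i => by
    rw [Matrix.mulVec, dotProduct, Finset.sum_eq_single ⟨0, hn⟩]
    · simp [hLC]
    · intro j _ hj
      rw [hLC, if_neg fun h => hj (Fin.ext h), zero_mul]
    · simp
  intro τ
  rw [hΛinv, hasDerivAt_pi]
  intro i
  have hscale : HasDerivAt (fun s : ℝ => s / lam) (1 / lam) τ := (hasDerivAt_id τ).div_const lam
  have hcomp := ((hasDerivAt_pi.mp (he (τ / lam)) i).comp τ hscale).const_mul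
    (lam⁻¹ ^ ((i : ℕ) + 1))
  simp only [hΛ]
  refine hcomp.congr_deriv ?_
  have hpow : lam⁻¹ ^ ((i : ℕ) + 1) * lam ^ ((i : ℕ) + 1) = 1 := by
    rw [← mul_pow, inv_mul_cancel₀ hlam.ne', one_pow]
  simp only [Matrix.sub_mulVec, Pi.add_apply, Pi.sub_apply, Pi.smul_apply, smul_eq_mul, hAΛ,
    hLCx, hΛ, one_div, zero_add, pow_one]
  linear_combination -(lam⁻¹ * (L i * e (τ / lam) ⟨0, hn⟩)) * hpow
end

section
/- For every integer n ≥ 1, the polynomial q(σ) = Σ_{j=0}^{n} binom(n,j)·(n!/j!)·σ^j has n distinct real roots, all of which are strictly negative; that is, there exist real numbers σ₁ < σ₂ < ⋯ < σₙ < 0 with q(σᵢ) = 0 for every i = 1,…,n. -/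
open Polynomial Filter Topology

/-- The polynomial `∑ j ≤ n, binom(n,j) (n!/j!) X^j`, that is, `n! L_n(-X)` for the Laguerre
polynomial `L_n`. -/
noncomputable def negLaguerre (n : ℕ) : ℝ[X] :=
  ∑ j ∈ Finset.range (n + 1),
    C ((n.choose j : ℝ) * ((n.factorial : ℝ) / (j.factorial : ℝ))) * X ^ j

theorem eval_negLaguerre (n : ℕ) (x : ℝ) :
    (negLaguerre n).eval x = ∑ j ∈ Finset.range (n + 1),
      (n.choose j : ℝ) * ((n.factorial : ℝ) / (j.factorial : ℝ)) * x ^ j := by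
  simp [negLaguerre, eval_finsetSum]

theorem coeff_negLaguerre (n j : ℕ) :
    (negLaguerre n).coeff j = (n.choose j : ℝ) * ((n.factorial : ℝ) / (j.factorial : ℝ)) := by
  simp only [negLaguerre, finsetSum_coeff, coeff_C_mul_X_pow, Finset.sum_ite_eq,
    Finset.mem_range]
  split_ifs with h
  · rfl
  · rw [Nat.choose_eq_zero_of_lt (by omega)]
    simp

theorem negLaguerre_succ (n : ℕ) :
    negLaguerre (n + 1) =
      X * derivative (negLaguerre n) + X * negLaguerre n + C ((n : ℝ) + 1) * negLaguerre n := by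
  ext j
  cases j with
  | zero =>
    simp only [coeff_add, mul_coeff_zero, coeff_X_zero, coeff_negLaguerre]
    simp [Nat.factorial_succ]
  | succ j =>
    simp only [coeff_add, coeff_C_mul, coeff_X_mul, coeff_derivative, coeff_negLaguerre]
    have hc : ((n : ℝ) + 1) * n.choose j = (n.choose j + n.choose (j + 1)) * (j + 1) := by
      have h := Nat.add_one_mul_choose_eq n j
      rw [Nat.choose_succ_succ] at h
      exact_mod_cast h
    have hj : (j.factorial : ℝ) ≠ 0 := by positivity
    rw [Nat.choose_succ_succ, Nat.factorial_succ, Nat.factorial_succ]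
    push_cast
    field_simp
    linear_combination hc

theorem X_pow_mul_negLaguerre_succ (n : ℕ) :
    derivative (X ^ (n + 1) * negLaguerre n) + X ^ (n + 1) * negLaguerre n =
      X ^ n * negLaguerre (n + 1) := by
  rw [negLaguerre_succ, derivative_mul, derivative_X_pow]
  simp only [Nat.add_sub_cancel, Nat.cast_add, Nat.cast_one]
  ring

theorem hasDerivAt_eval_mul_exp (p : ℝ[X]) (x : ℝ) :
    HasDerivAt (fun y => p.eval y * Real.exp y) ((derivative p + p).eval x * Real.exp x) x := by
  rw [eval_add, add_mul]
  exact (p.hasDerivAt x).mul (Real.hasDerivAt_exp x)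

/-- Rolle's theorem for `p(x) eˣ` between two roots of `p`. -/
theorem exists_eval_derivative_add_self_eq_zero (p : ℝ[X]) {a b : ℝ} (hab : a < b)
    (ha : p.eval a = 0) (hb : p.eval b = 0) :
    ∃ t, a < t ∧ t < b ∧ (derivative p + p).eval t = 0 := by
  obtain ⟨t, ht, h⟩ := exists_hasDerivAt_eq_zero hab
    (fun x _ => (hasDerivAt_eval_mul_exp p x).continuousAt.continuousWithinAt)
    (by simp only [ha, hb, zero_mul]) (fun x _ => hasDerivAt_eval_mul_exp p x)
  exact ⟨t, ht.1, ht.2, (mul_eq_zero.1 h).resolve_right (Real.exp_ne_zero t)⟩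

theorem tendsto_eval_mul_exp_atBot (p : ℝ[X]) :
    Tendsto (fun x => p.eval x * Real.exp x) atBot (𝓝 0) := by
  have h := ((p.comp (-X)).tendsto_div_exp_atTop).comp tendsto_neg_atBot_atTop
  refine h.congr fun x => ?_
  simp [Real.exp_neg]

/-- Rolle's theorem for `p(x) eˣ` between `-∞` and a root of `p`. -/
theorem exists_lt_eval_derivative_add_self_eq_zero (p : ℝ[X]) {b : ℝ} (hb : p.eval b = 0) :
    ∃ t, t < b ∧ (derivative p + p).eval t = 0 := by
  have hb' : Tendsto (fun y => p.eval (Real.log y) * Real.exp (Real.log y))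
      (𝓝[<] Real.exp b) (𝓝 0) := by
    have h := (hasDerivAt_eval_mul_exp p (Real.log (Real.exp b))).continuousAt.comp
      (Real.continuousAt_log (Real.exp_ne_zero b))
    have h' := h.tendsto.mono_left (nhdsWithin_le_nhds (s := Set.Iio (Real.exp b)))
    simpa only [Function.comp_def, Real.log_exp, hb, zero_mul] using h'
  obtain ⟨y, hy, h⟩ := exists_hasDerivAt_eq_zero' (Real.exp_pos b)
    ((tendsto_eval_mul_exp_atBot p).comp Real.tendsto_log_nhdsGT_zero) hb'
    (fun y hy => (hasDerivAt_eval_mul_exp p (Real.log y)).comp y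
      (Real.hasDerivAt_log hy.1.ne'))
  refine ⟨Real.log y, (Real.log_lt_iff_lt_exp hy.1).2 hy.2, ?_⟩
  have hinv : y⁻¹ ≠ 0 := inv_ne_zero hy.1.ne'
  exact (mul_eq_zero.1 ((mul_eq_zero.1 h).resolve_right hinv)).resolve_right (Real.exp_ne_zero _)

/-- If `p` has `m` distinct real roots, then `p' + p` has `m` roots interlacing them
from the left. -/
theorem exists_strictMono_eval_derivative_add_self_eq_zero (p : ℝ[X]) {m : ℕ} {s : Fin m → ℝ}
    (hs : StrictMono s) (h0 : ∀ i, p.eval (s i) = 0) :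
    ∃ τ : Fin m → ℝ, StrictMono τ ∧ (∀ i, τ i < s i) ∧
      ∀ i, (derivative p + p).eval (τ i) = 0 := by
  have key : ∀ i, ∃ t, t < s i ∧ (∀ j < i, s j < t) ∧ (derivative p + p).eval t = 0 := by
    intro i
    cases m with
    | zero => exact i.elim0
    | succ m =>
      cases i using Fin.cases with
      | zero =>
        obtain ⟨t, ht, h⟩ := exists_lt_eval_derivative_add_self_eq_zero p (h0 0)
        exact ⟨t, ht, fun j hj => absurd hj (Fin.not_lt_zero j), h⟩
      | succ i =>
        obtain ⟨t, hat, htb, h⟩ := exists_eval_derivative_add_self_eq_zero p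
          (hs i.castSucc_lt_succ) (h0 _) (h0 _)
        exact ⟨t, htb, fun j hj =>
          (hs.monotone (Fin.le_castSucc_iff.2 hj)).trans_lt hat, h⟩
  choose τ hlt hgt hroot using key
  exact ⟨τ, fun i j hij => (hlt i).trans (hgt j i hij), hlt, hroot⟩

theorem exists_roots_negLaguerre (n : ℕ) :
    ∃ σ : Fin n → ℝ, StrictMono σ ∧ (∀ i, σ i < 0) ∧ ∀ i, (negLaguerre n).eval (σ i) = 0 := by
  induction n with
  | zero => exact ⟨Fin.elim0, fun i => i.elim0, fun i => i.elim0, fun i => i.elim0⟩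
  | succ n ih =>
    obtain ⟨σ, hσ, hneg, hroot⟩ := ih
    let s : Fin (n + 1) → ℝ := Fin.snoc σ 0
    have hs : StrictMono s := by
      intro i j hij
      cases j using Fin.lastCases with
      | last =>
        cases i using Fin.lastCases with
        | last => exact absurd hij (lt_irrefl _)
        | cast i => simpa [s] using hneg i
      | cast j =>
        cases i using Fin.lastCases with
        | last => exact absurd hij (Fin.castSucc_lt_last j).not_gt
        | cast i => simpa [s] using hσ (Fin.castSucc_lt_castSucc_iff.1 hij)
    have hs0 : ∀ i, s i ≤ 0 := by
      intro i
      cases i using Fin.lastCases with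
      | last => simp [s]
      | cast i => simpa [s] using (hneg i).le
    have h0 : ∀ i, (X ^ (n + 1) * negLaguerre n).eval (s i) = 0 := by
      intro i
      cases i using Fin.lastCases with
      | last => simp [s]
      | cast i => simp [s, hroot i]
    obtain ⟨τ, hτ, hlt, hτ0⟩ := exists_strictMono_eval_derivative_add_self_eq_zero _ hs h0
    have hτneg : ∀ i, τ i < 0 := fun i => (hlt i).trans_le (hs0 i)
    refine ⟨τ, hτ, hτneg, fun i => ?_⟩
    have h := hτ0 i
    rw [X_pow_mul_negLaguerre_succ, eval_mul, eval_pow, eval_X] at h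
    exact (mul_eq_zero.1 h).resolve_left (pow_ne_zero n (hτneg i).ne)

/-- For every `n ≥ 1`, the polynomial
`q(σ) = Σ_{j=0}^{n} binom(n,j)·(n!/j!)·σ^j` has `n` distinct, strictly negative real
roots: there are `σ₁ < σ₂ < ⋯ < σₙ < 0` with `q(σᵢ) = 0` for all `i`. -/
theorem q_has_n_negative_distinct_roots (n : ℕ) (hn : 1 ≤ n) :
    ∃ σ : Fin n → ℝ, StrictMono σ ∧ (∀ i, σ i < 0) ∧
      ∀ i, ∑ j ∈ Finset.range (n + 1),
        (n.choose j : ℝ) * ((n.factorial : ℝ) / (j.factorial : ℝ)) * σ i ^ j = 0 := by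
  obtain ⟨σ, hσ, hneg, hroot⟩ := exists_roots_negLaguerre n
  exact ⟨σ, hσ, hneg, fun i => eval_negLaguerre n (σ i) ▸ hroot i⟩
end

section
/- Let n ≥ 1 and δ > 0. Let σ⋆ be the largest real root of q, and define L⋆ = (l⋆₁,…,l⋆ₙ) ∈ ℝⁿ by l⋆_k = Σ_{j=n−k+1}^{n} Σ_{i=1}^{j} (−1)^{n+j+k}·binom(n, j−i)·binom(j−1, n−k)·(σ⋆^{i−1}/(i−1)!)·σ⋆^{k}·e^{σ⋆}, for k = 1,…,n. Let L = (l₁,…,lₙ) with l_k = l⋆_k/δ^k. Then the entire function D_δ^L(s) = s^n + (l₁ s^{n−1} + l₂ s^{n−2} + ⋯ + lₙ)·e^{−δs} has a zero of multiplicity exactly n+1 at s = σ⋆/δ, and this zero is dominant: every s ∈ ℂ with D_δ^L(s) = 0 satisfies Re(s) ≤ σ⋆/δ. -/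
open Finset in
/-- The `m`-th derivative at `t` of the kernel `t ↦ ∑ i, binom(n,i) (σ t)^i / i!`. -/
noncomputable def laguerreKernel (n : ℕ) (σ : ℝ) (m : ℕ) (t : ℝ) : ℝ :=
  ∑ i ∈ range (n + 1), (n.choose (m + i) : ℝ) * σ ^ (m + i) * (t ^ i / (i.factorial : ℝ))

namespace laguerreKernel

open Finset

variable {n : ℕ} {σ : ℝ}

lemma hasDerivAt (n : ℕ) (σ : ℝ) (m : ℕ) (t : ℝ) :
    HasDerivAt (laguerreKernel n σ m) (laguerreKernel n σ (m + 1) t) t := by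
  have h : HasDerivAt (laguerreKernel n σ m)
      (∑ i ∈ range (n + 1), (n.choose (m + i) : ℝ) * σ ^ (m + i) *
        ((i : ℝ) * t ^ (i - 1) / (i.factorial : ℝ))) t :=
    HasDerivAt.fun_sum fun i _ => ((hasDerivAt_pow i t).div_const _).const_mul _
  convert h using 1
  rw [laguerreKernel, sum_range_succ, sum_range_succ', Nat.choose_eq_zero_of_lt (by omega)]
  simp only [Nat.cast_zero, zero_mul, add_zero, zero_div, mul_zero]
  refine sum_congr rfl fun i _ => ?_
  have : (i.factorial : ℝ) ≠ 0 := by positivity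
  have : (i : ℝ) + 1 ≠ 0 := by positivity
  rw [show m + 1 + i = m + (i + 1) by ring, Nat.factorial_succ]
  push_cast
  field_simp

lemma continuous (n : ℕ) (σ : ℝ) (m : ℕ) : Continuous (laguerreKernel n σ m) :=
  continuous_iff_continuousAt.2 fun t => (hasDerivAt n σ m t).continuousAt

lemma eq_zero_of_lt {m : ℕ} (h : n < m) (t : ℝ) : laguerreKernel n σ m t = 0 :=
  sum_eq_zero fun i _ => by rw [Nat.choose_eq_zero_of_lt (by omega)]; simp

lemma at_zero (n : ℕ) (σ : ℝ) (m : ℕ) : laguerreKernel n σ m 0 = n.choose m * σ ^ m := by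
  rw [laguerreKernel, sum_range_succ']
  simp

lemma mul_succ (n : ℕ) (σ : ℝ) (m : ℕ) (t : ℝ) :
    t * laguerreKernel n σ (m + 1) t = ∑ i ∈ range (n + 1),
      (i : ℝ) * ((n.choose (m + i) : ℝ) * σ ^ (m + i) * (t ^ i / (i.factorial : ℝ))) := by
  rw [laguerreKernel, sum_range_succ, sum_range_succ', Nat.choose_eq_zero_of_lt (by omega), mul_add,
    mul_sum]
  simp only [Nat.cast_zero, zero_mul, add_zero, mul_zero]
  refine sum_congr rfl fun i _ => ?_
  have : (i.factorial : ℝ) ≠ 0 := by positivity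
  have : (i : ℝ) + 1 ≠ 0 := by positivity
  rw [show m + 1 + i = m + (i + 1) by ring, Nat.factorial_succ]
  push_cast
  field_simp
  ring

/-- Laguerre's differential equation. -/
lemma ode (n : ℕ) (σ t : ℝ) :
    t * laguerreKernel n σ 2 t + (1 + σ * t) * laguerreKernel n σ 1 t =
      n * σ * laguerreKernel n σ 0 t := by
  have h1 := mul_succ n σ 1 t
  have h0 := mul_succ n σ 0 t
  rw [add_mul, one_mul, mul_assoc σ, h1, h0]
  simp only [laguerreKernel, mul_sum, ← sum_add_distrib]
  refine sum_congr rfl fun i _ => ?_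
  have hc : (n.choose (1 + i) : ℝ) * (i + 1) + n.choose i * i = n * n.choose i := by
    rcases le_or_gt i n with h | h
    · have := Nat.choose_succ_right_eq n i
      rw [add_comm 1 i]
      have : (n.choose (i + 1) : ℝ) * (i + 1) = n.choose i * (n - i) := by
        rw [← Nat.cast_sub h]; exact_mod_cast this
      linarith
    · rw [Nat.choose_eq_zero_of_lt h, Nat.choose_eq_zero_of_lt (by omega)]; simp
  rw [zero_add, pow_add, pow_one]
  linear_combination (σ * σ ^ i * (t ^ i / (i.factorial : ℝ))) * hc

lemma factorial_mul (n : ℕ) (σ t : ℝ) :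
    (n.factorial : ℝ) * laguerreKernel n σ 0 t = ∑ j ∈ range (n + 1),
      (n.choose j : ℝ) * ((n.factorial : ℝ) / (j.factorial : ℝ)) * (σ * t) ^ j := by
  rw [laguerreKernel, mul_sum]
  refine sum_congr rfl fun i _ => ?_
  rw [zero_add, mul_pow]
  ring

lemma pos (hpos : ∀ t, 0 ≤ t → t < 1 → laguerreKernel n σ 0 t ≠ 0) {t : ℝ} (h0 : 0 ≤ t)
    (h1 : t < 1) : 0 < laguerreKernel n σ 0 t := by
  by_contra! h
  have hk0 : laguerreKernel n σ 0 0 = 1 := by simp [at_zero]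
  obtain ⟨x, hx, hx0⟩ := intermediate_value_Icc' h0 (continuous n σ 0).continuousOn
    ⟨h, by rw [hk0]; exact zero_le_one⟩
  exact hpos x hx.1 (hx.2.trans_lt h1) hx0

lemma deriv_neg (hσ : σ < 0) (hpos : ∀ t, 0 ≤ t → t < 1 → laguerreKernel n σ 0 t ≠ 0)
    (hn : 1 ≤ n) {t : ℝ} (h0 : 0 < t) (h1 : t < 1) : laguerreKernel n σ 1 t < 0 := by
  have hd (x : ℝ) : HasDerivAt (fun x => x * laguerreKernel n σ 1 x * Real.exp (σ * x))
      (n * σ * laguerreKernel n σ 0 x * Real.exp (σ * x)) x := by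
    refine (((hasDerivAt_id' x).fun_mul (hasDerivAt n σ 1 x)).fun_mul
      (((hasDerivAt_id' x).const_mul σ).exp)).congr_deriv ?_
    rw [← ode]
    ring
  have hanti : StrictAntiOn (fun x => x * laguerreKernel n σ 1 x * Real.exp (σ * x))
      (Set.Icc 0 t) := by
    refine strictAntiOn_of_deriv_neg (convex_Icc 0 t)
      (fun x _ => (hd x).continuousAt.continuousWithinAt) fun x hx => ?_
    rw [interior_Icc] at hx
    rw [(hd x).deriv]
    have hn' : (0 : ℝ) < n := by exact_mod_cast hn
    have := pos hpos hx.1.le (hx.2.trans h1)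
    have := mul_neg_of_pos_of_neg hn' hσ
    exact mul_neg_of_neg_of_pos (mul_neg_of_neg_of_pos this ‹_›) (Real.exp_pos _)
  have := hanti (Set.left_mem_Icc.2 h0.le) (Set.right_mem_Icc.2 h0.le) h0
  simp only [zero_mul] at this
  have h2 := neg_of_mul_neg_left this (Real.exp_pos _).le
  exact neg_of_mul_neg_right h2 h0.le

lemma hasDerivAt_cexp_neg_mul (w : ℂ) (t : ℝ) :
    HasDerivAt (fun x : ℝ => Complex.exp (-(w * x))) (-w * Complex.exp (-(w * t))) t :=
  ((((hasDerivAt_id' (t : ℂ)).const_mul w).fun_neg.cexp).comp_ofReal).congr_deriv (by ring)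

/-- Repeated integration by parts for the Laplace transform of the kernel over `[0, 1]`. -/
lemma pow_mul_integral (n : ℕ) (σ : ℝ) (w : ℂ) :
    w ^ (n + 1) * ∫ t in (0 : ℝ)..1, (laguerreKernel n σ 0 t : ℂ) * Complex.exp (-(w * t)) =
      ∑ m ∈ range (n + 1), (laguerreKernel n σ m 0 : ℂ) * w ^ (n - m) -
        Complex.exp (-w) * ∑ m ∈ range (n + 1), (laguerreKernel n σ m 1 : ℂ) * w ^ (n - m) := by
  have hd (t : ℝ) : HasDerivAt (fun t : ℝ => -(Complex.exp (-(w * t)) *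
      ∑ m ∈ range (n + 1), (laguerreKernel n σ m t : ℂ) * w ^ (n - m)))
      (w ^ (n + 1) * ((laguerreKernel n σ 0 t : ℂ) * Complex.exp (-(w * t)))) t := by
    have hs : HasDerivAt
        (fun t : ℝ => ∑ m ∈ range (n + 1), (laguerreKernel n σ m t : ℂ) * w ^ (n - m))
        (∑ m ∈ range (n + 1), (laguerreKernel n σ (m + 1) t : ℂ) * w ^ (n - m)) t :=
      HasDerivAt.fun_sum fun m _ => (hasDerivAt n σ m t).ofReal_comp.mul_const _
    refine ((hasDerivAt_cexp_neg_mul w t).fun_mul hs).fun_neg.congr_deriv ?_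
    have htel : w * ∑ m ∈ range (n + 1), (laguerreKernel n σ m t : ℂ) * w ^ (n - m) =
        ∑ m ∈ range (n + 1), (laguerreKernel n σ (m + 1) t : ℂ) * w ^ (n - m) +
          w ^ (n + 1) * laguerreKernel n σ 0 t := by
      rw [sum_range_succ', sum_range_succ _ n, eq_zero_of_lt (Nat.lt_succ_self n), mul_add, mul_sum]
      have : ∀ m ∈ range n, w * ((laguerreKernel n σ (m + 1) t : ℂ) * w ^ (n - (m + 1))) =
          (laguerreKernel n σ (m + 1) t : ℂ) * w ^ (n - m) := fun m hm => by
        rw [mem_range] at hm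
        rw [show n - m = n - (m + 1) + 1 by omega]
        ring
      rw [sum_congr rfl this]
      simp only [Complex.ofReal_zero, zero_mul, add_zero, Nat.sub_zero]
      ring
    linear_combination Complex.exp (-(w * t)) * htel
  have hc : Continuous fun t : ℝ =>
      w ^ (n + 1) * ((laguerreKernel n σ 0 t : ℂ) * Complex.exp (-(w * t))) := by
    have := continuous n σ 0
    fun_prop
  rw [← intervalIntegral.integral_const_mul, intervalIntegral.integral_eq_sub_of_hasDerivAt
    (fun t _ => hd t) (hc.intervalIntegrable _ _)]
  simp
  ring

lemma integral_ne_zero (hn : 1 ≤ n) (hσ : σ < 0) (hone : laguerreKernel n σ 0 1 = 0)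
    (hpos : ∀ t, 0 ≤ t → t < 1 → laguerreKernel n σ 0 t ≠ 0) {w : ℂ} (hw : 0 < w.re) :
    ∫ t in (0 : ℝ)..1, (laguerreKernel n σ 0 t : ℂ) * Complex.exp (-(w * t)) ≠ 0 := by
  intro h0
  have hc0 := continuous n σ 0
  have hc1 := continuous n σ 1
  have hzero : laguerreKernel n σ 0 0 = 1 := by simp [at_zero]
  have hparts : ∫ t in (0 : ℝ)..1, (laguerreKernel n σ 1 t : ℂ) * Complex.exp (-(w * t)) = -1 := by
    have hd (t : ℝ) : HasDerivAt
        (fun t : ℝ => (laguerreKernel n σ 0 t : ℂ) * Complex.exp (-(w * t)))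
        ((laguerreKernel n σ 1 t : ℂ) * Complex.exp (-(w * t)) -
          w * ((laguerreKernel n σ 0 t : ℂ) * Complex.exp (-(w * t)))) t :=
      ((hasDerivAt n σ 0 t).ofReal_comp.fun_mul (hasDerivAt_cexp_neg_mul w t)).congr_deriv (by ring)
    have := intervalIntegral.integral_eq_sub_of_hasDerivAt (a := 0) (b := 1) (fun t _ => hd t)
      (Continuous.intervalIntegrable (by fun_prop) _ _)
    rw [intervalIntegral.integral_sub (Continuous.intervalIntegrable (by fun_prop) _ _)
      (Continuous.intervalIntegrable (by fun_prop) _ _), intervalIntegral.integral_const_mul, h0,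
      hone, hzero] at this
    simpa using this
  have htotal : ∫ t in (0 : ℝ)..1, -laguerreKernel n σ 1 t = 1 := by
    rw [intervalIntegral.integral_neg, intervalIntegral.integral_eq_sub_of_hasDerivAt
      (fun t _ => hasDerivAt n σ 0 t) (hc1.intervalIntegrable _ _), hone, hzero]
    norm_num
  have hle : ∀ t ∈ Set.Icc (0 : ℝ) 1, laguerreKernel n σ 1 t ≤ 0 := by
    have hcl : IsClosed {t | laguerreKernel n σ 1 t ≤ 0} := isClosed_le hc1 continuous_const
    have := hcl.closure_subset_iff.2
      fun t (ht : t ∈ Set.Ioo (0 : ℝ) 1) => (deriv_neg hσ hpos hn ht.1 ht.2).le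
    rwa [closure_Ioo zero_ne_one] at this
  have hnorm (t : ℝ) : ‖(laguerreKernel n σ 1 t : ℂ) * Complex.exp (-(w * t))‖ =
      |laguerreKernel n σ 1 t| * Real.exp (-(w.re * t)) := by
    rw [norm_mul, Complex.norm_real, Complex.norm_exp, Real.norm_eq_abs]
    simp
  have hlt : ∫ t in (0 : ℝ)..1, ‖(laguerreKernel n σ 1 t : ℂ) * Complex.exp (-(w * t))‖ <
      ∫ t in (0 : ℝ)..1, -laguerreKernel n σ 1 t := by
    refine intervalIntegral.integral_lt_integral_of_continuousOn_of_le_of_exists_lt zero_lt_one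
      (Continuous.continuousOn (by fun_prop)) (Continuous.continuousOn (by fun_prop))
      (fun t ht => ?_) ⟨1 / 2, by norm_num, ?_⟩
    · have hk := hle t (Set.Ioc_subset_Icc_self ht)
      rw [hnorm, abs_of_nonpos hk]
      refine mul_le_of_le_one_right (neg_nonneg.2 hk) (Real.exp_le_one_iff.2 ?_)
      have := mul_pos hw ht.1
      linarith
    · have hk := deriv_neg hσ hpos hn (t := 1 / 2) (by norm_num) (by norm_num)
      rw [hnorm, abs_of_neg hk]
      refine mul_lt_of_lt_one_right (neg_pos.2 hk) (Real.exp_lt_one_iff.mpr ?_)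
      linarith
  have hfin := (intervalIntegral.norm_integral_le_integral_norm zero_le_one).trans_lt hlt
  rw [hparts, htotal] at hfin
  simp at hfin

lemma integral_pos (hpos : ∀ t, 0 ≤ t → t < 1 → laguerreKernel n σ 0 t ≠ 0) :
    0 < ∫ t in (0 : ℝ)..1, laguerreKernel n σ 0 t :=
  intervalIntegral.intervalIntegral_pos_of_pos_on ((continuous n σ 0).intervalIntegrable _ _)
    (fun _ ht => pos hpos ht.1.le ht.2) zero_lt_one

lemma sum_at_zero (n : ℕ) (σ : ℝ) (w : ℂ) :
    ∑ m ∈ range (n + 1), (laguerreKernel n σ m 0 : ℂ) * w ^ (n - m) = (w + σ) ^ n := by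
  rw [add_comm w, add_pow]
  refine sum_congr rfl fun m _ => ?_
  rw [at_zero]
  push_cast
  ring

lemma at_one (n : ℕ) (σ : ℝ) {j : ℕ} (h1 : 1 ≤ j) (hj : j ≤ n) :
    laguerreKernel n σ (n + 1 - j) 1 = ∑ i ∈ Icc 1 j,
      (n.choose (j - i) : ℝ) * (σ ^ (n + 1 - j) * (σ ^ (i - 1) / ((i - 1).factorial : ℝ))) := by
  rw [← Ico_add_one_right_eq_Icc, sum_Ico_eq_sum_range, laguerreKernel,
    show n + 1 = (j + 1 - 1) + (n + 1 - j) by omega, sum_range_add,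
    show (j + 1 - 1) + (n + 1 - j) - j = n + 1 - j by omega]
  rw [sum_eq_zero (s := range (n + 1 - j)), add_zero]
  · refine sum_congr rfl fun i hi => ?_
    rw [mem_range] at hi
    rw [← Nat.choose_symm (show j - (1 + i) ≤ n by omega),
      show n - (j - (1 + i)) = n + 1 - j + i by omega, pow_add, Nat.add_sub_cancel_left]
    ring
  · intro i _
    rw [Nat.choose_eq_zero_of_lt (by omega)]
    simp

lemma sum_gain (hone : laguerreKernel n σ 0 1 = 0) {l : Fin n → ℝ}
    (hl : ∀ k : Fin n, l k =
      ∑ j ∈ Icc (n - ((k : ℕ) + 1) + 1) n, ∑ i ∈ Icc 1 j,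
        (-1 : ℝ) ^ (n + j + ((k : ℕ) + 1)) * (n.choose (j - i) : ℝ) *
          ((j - 1).choose (n - ((k : ℕ) + 1)) : ℝ) *
          (σ ^ (i - 1) / ((i - 1).factorial : ℝ)) * σ ^ ((k : ℕ) + 1) * Real.exp σ) (z : ℂ) :
    ∑ k : Fin n, (l k : ℂ) * z ^ (n - 1 - (k : ℕ)) =
      -(Complex.exp σ *
        ∑ m ∈ range (n + 1), (laguerreKernel n σ m 1 : ℂ) * (z - σ) ^ (n - m)) := by
  have hl' (r : ℕ) (hr : r < n) : ∀ k : Fin n, (k : ℕ) = n - 1 - r → (l k : ℂ) =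
      ∑ j ∈ range n, -(Complex.exp σ * (laguerreKernel n σ (n - j) 1 : ℂ) *
        ((-σ) ^ (j - r) * j.choose r)) := by
    rintro k hk
    have hlk : l k = ∑ j ∈ range n, -(Real.exp σ * laguerreKernel n σ (n - j) 1 *
        ((-σ) ^ (j - r) * j.choose r)) := by
      rw [hl, hk, show n - (n - 1 - r + 1) = r by omega, show n - 1 - r + 1 = n - r by omega,
        range_eq_Ico, ← sum_Ico_consecutive _ (Nat.zero_le r) hr.le,
        sum_eq_zero (s := Ico 0 r), zero_add, ← Ico_add_one_right_eq_Icc,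
        ← sum_Ico_add' _ r n 1]
      · refine sum_congr rfl fun j hj => ?_
        rw [mem_Ico] at hj
        rw [show n - j = n + 1 - (j + 1) by omega, at_one n σ (by omega) (by omega), mul_sum,
          sum_mul, ← sum_neg_distrib]
        refine sum_congr rfl fun i _ => ?_
        obtain ⟨a, rfl⟩ := Nat.exists_eq_add_of_le hj.1
        obtain ⟨b, rfl⟩ := Nat.exists_eq_add_of_le (show r + a + 1 ≤ n by omega)
        rw [show r + a + 1 + b + 1 - (r + a + 1) = b + 1 by omega,
          show r + a + 1 + b - r = a + b + 1 by omega,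
          show r + a - r = a by omega, Nat.add_sub_cancel,
          show r + a + 1 + b + (r + a + 1) + (a + b + 1) = 2 * (r + a + b + 1) + (a + 1) by ring,
          pow_add, pow_mul, neg_pow σ a]
        ring
      · intro j hj
        rw [mem_Ico] at hj
        rw [Nat.choose_eq_zero_of_lt hj.2]
        simp
    rw [hlk]
    push_cast
    rfl
  have hexp : ∀ j ∈ range n, (z - σ) ^ j =
      ∑ r ∈ range n, z ^ r * (-(σ : ℂ)) ^ (j - r) * j.choose r := by
    intro j hj
    rw [mem_range] at hj
    rw [sub_eq_add_neg, add_pow]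
    refine sum_subset (range_subset_range.2 hj) fun r _ hr => ?_
    rw [mem_range] at hr
    rw [Nat.choose_eq_zero_of_lt (by omega)]
    simp
  calc ∑ k : Fin n, (l k : ℂ) * z ^ (n - 1 - (k : ℕ))
      = ∑ k : Fin n, (fun r => (∑ j ∈ range n, -(Complex.exp σ *
          (laguerreKernel n σ (n - j) 1 : ℂ) * ((-σ) ^ (j - r) * j.choose r))) * z ^ r)
          (n - 1 - (k : ℕ)) :=
        sum_congr rfl fun k _ => by
          have := k.2
          rw [hl' (n - 1 - k) (by omega) k (by omega)]
    _ = ∑ r ∈ range n, (∑ j ∈ range n, -(Complex.exp σ *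
          (laguerreKernel n σ (n - j) 1 : ℂ) * ((-σ) ^ (j - r) * j.choose r))) * z ^ r := by
        rw [← sum_range_reflect, Finset.sum_range]
    _ = ∑ j ∈ range n, -(Complex.exp σ *
          ((laguerreKernel n σ (n - j) 1 : ℂ) * (z - σ) ^ j)) := by
        simp only [sum_mul]
        rw [sum_comm]
        refine sum_congr rfl fun j hj => ?_
        rw [hexp j hj, mul_sum, mul_sum, ← sum_neg_distrib]
        exact sum_congr rfl fun r _ => by ring
    _ = _ := by
        rw [sum_range_succ', hone, ← sum_range_reflect, sum_neg_distrib, ← mul_sum]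
        simp only [Complex.ofReal_zero, zero_mul, add_zero]
        congr 2
        refine sum_congr rfl fun j hj => ?_
        rw [mem_range] at hj
        rw [show n - (n - 1 - j) = j + 1 by omega, show n - 1 - j = n - (j + 1) by omega]

end laguerreKernel

/-- MID tuning, Theorem of Rojas et al.: with `σ⋆` the largest real root
of `q(σ) = Σ_{j=0}^{n} binom(n,j)(n!/j!)σ^j`, the explicit gain `L⋆` scaled by
`l_k = l⋆_k/δ^k` makes the quasipolynomial
`D_δ^L(s) = s^n + (l₁ s^{n−1} + ⋯ + lₙ) e^{−δs}` have a dominant zero of multiplicity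
exactly `n+1` at `s = σ⋆/δ`: the first `n` derivatives of `D` vanish at `σ⋆/δ`, the
`(n+1)`-st does not, and every zero `s` of `D` satisfies `Re(s) ≤ σ⋆/δ`. -/
theorem mid_dominant_multiple_root
    (n : ℕ) (hn : 1 ≤ n) (δ : ℝ) (hδ : 0 < δ)
    (σs : ℝ)
    (hroot : ∑ j ∈ Finset.range (n + 1),
      (n.choose j : ℝ) * ((n.factorial : ℝ) / (j.factorial : ℝ)) * σs ^ j = 0)
    (hmax : ∀ σ : ℝ, (∑ j ∈ Finset.range (n + 1),
      (n.choose j : ℝ) * ((n.factorial : ℝ) / (j.factorial : ℝ)) * σ ^ j) = 0 → σ ≤ σs)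
    (Lstar : Fin n → ℝ)
    (hLstar : ∀ k : Fin n, Lstar k =
      ∑ j ∈ Finset.Icc (n - ((k : ℕ) + 1) + 1) n, ∑ i ∈ Finset.Icc 1 j,
        (-1 : ℝ) ^ (n + j + ((k : ℕ) + 1)) * (n.choose (j - i) : ℝ) *
          ((j - 1).choose (n - ((k : ℕ) + 1)) : ℝ) *
          (σs ^ (i - 1) / ((i - 1).factorial : ℝ)) * σs ^ ((k : ℕ) + 1) * Real.exp σs)
    (L : Fin n → ℝ) (hL : ∀ k : Fin n, L k = Lstar k / δ ^ ((k : ℕ) + 1))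
    (D : ℂ → ℂ)
    (hD : ∀ s : ℂ, D s =
      s ^ n + (∑ k : Fin n, (L k : ℂ) * s ^ (n - 1 - (k : ℕ))) * Complex.exp (-(δ : ℂ) * s)) :
    (∀ m ≤ n, iteratedDeriv m D ((σs / δ : ℝ) : ℂ) = 0) ∧
    iteratedDeriv (n + 1) D ((σs / δ : ℝ) : ℂ) ≠ 0 ∧
    ∀ s : ℂ, D s = 0 → s.re ≤ σs / δ := by
  have hfac : (n.factorial : ℝ) ≠ 0 := by positivity
  have hroot_iff (t : ℝ) : laguerreKernel n σs 0 t = 0 ↔ ∑ j ∈ Finset.range (n + 1),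
      (n.choose j : ℝ) * ((n.factorial : ℝ) / (j.factorial : ℝ)) * (σs * t) ^ j = 0 := by
    rw [← laguerreKernel.factorial_mul, mul_eq_zero, or_iff_right hfac]
  have hσ : σs < 0 := by
    by_contra! h
    rw [Finset.sum_range_succ'] at hroot
    have : 0 ≤ ∑ k ∈ Finset.range n, (n.choose (k + 1) : ℝ) *
        ((n.factorial : ℝ) / ((k + 1).factorial : ℝ)) * σs ^ (k + 1) :=
      Finset.sum_nonneg fun k _ => by positivity
    have : (0 : ℝ) < n.factorial := by positivity
    simp at hroot
    linarith
  have hone : laguerreKernel n σs 0 1 = 0 := by rwa [hroot_iff, mul_one]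
  have hpos : ∀ t, 0 ≤ t → t < 1 → laguerreKernel n σs 0 t ≠ 0 := fun t _ ht h => by
    have := hmax _ ((hroot_iff t).1 h)
    nlinarith
  have hδ' : (δ : ℂ) ≠ 0 := by exact_mod_cast hδ.ne'
  set a : ℂ := ((σs / δ : ℝ) : ℂ) with ha
  have hδa : (δ : ℂ) * a = σs := by
    rw [ha]
    push_cast
    field_simp
  set h : ℂ → ℂ := fun s => δ * ∫ t in (0 : ℝ)..1,
    (laguerreKernel n σs 0 t : ℂ) * Complex.exp (-((δ * (s - a)) * t)) with hh
  have hfactor (s : ℂ) : D s = (s - a) ^ (n + 1) * h s := by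
    have hgain : ∑ k : Fin n, (L k : ℂ) * s ^ (n - 1 - (k : ℕ)) = ((δ : ℂ) ^ n)⁻¹ *
        ∑ k : Fin n, (Lstar k : ℂ) * (δ * s) ^ (n - 1 - (k : ℕ)) := by
      rw [Finset.mul_sum]
      refine Finset.sum_congr rfl fun k _ => ?_
      obtain ⟨b, hb⟩ := Nat.exists_eq_add_of_le (Nat.succ_le_of_lt k.2)
      rw [hL, show n - 1 - (k : ℕ) = b by omega, show (δ : ℂ) ^ n = δ ^ ((k : ℕ) + 1) * δ ^ b by
        rw [← pow_add]; congr 1]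
      push_cast
      field_simp
      ring
    have hlap := laguerreKernel.pow_mul_integral n σs (δ * (s - a))
    rw [laguerreKernel.sum_at_zero, mul_sub, hδa, sub_add_cancel] at hlap
    rw [hD, hgain, laguerreKernel.sum_gain hone hLstar]
    have hexp : Complex.exp (-(δ * s - σs)) = Complex.exp σs * Complex.exp (-(δ : ℂ) * s) := by
      rw [← Complex.exp_add]
      congr 1
      ring
    rw [hexp] at hlap
    have hsub : (δ : ℂ) * s - σs = δ * (s - a) := by rw [mul_sub, hδa]
    have hδn : (δ : ℂ) ^ n ≠ 0 := pow_ne_zero _ hδ'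
    simp only [hh, ← hsub]
    refine mul_left_cancel₀ hδn ?_
    have hpow : (δ * s - σs : ℂ) ^ (n + 1) = δ ^ n * δ * (s - a) ^ (n + 1) := by
      rw [hsub, mul_pow, pow_succ (δ : ℂ)]
    rw [hpow, mul_pow] at hlap
    rw [mul_add, ← mul_assoc, ← mul_assoc, mul_inv_cancel₀ hδn]
    linear_combination -hlap
  have hDdiff : Differentiable ℂ D := by
    rw [funext hD]
    fun_prop
  have hcont : Continuous h := by
    have := laguerreKernel.continuous n σs 0
    exact continuous_const.mul
      (intervalIntegral.continuous_parametric_intervalIntegral_of_continuous' (by fun_prop) _ _)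
  have hhdiff : Differentiable ℂ h := by
    rw [← differentiableOn_univ, ← Complex.differentiableOn_compl_singleton_and_continuousAt_iff
      (c := a) Filter.univ_mem]
    refine ⟨DifferentiableOn.congr (f := fun s => D s / (s - a) ^ (n + 1)) ?_ fun s hs => ?_,
      hcont.continuousAt⟩
    · exact hDdiff.differentiableOn.fun_div (by fun_prop)
        fun s hs => pow_ne_zero _ (sub_ne_zero.2 hs.2)
    · rw [hfactor, mul_div_cancel_left₀ _ (pow_ne_zero _ (sub_ne_zero.2 hs.2))]
  have hha : h a ≠ 0 := by
    have : h a = δ * ((∫ t in (0 : ℝ)..1, laguerreKernel n σs 0 t : ℝ) : ℂ) := by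
      rw [← intervalIntegral.integral_ofReal]
      simp [hh]
    rw [this]
    exact mul_ne_zero hδ' (by exact_mod_cast (laguerreKernel.integral_pos hpos).ne')
  have hDan : AnalyticAt ℂ D a := hDdiff.analyticAt a
  have horder : analyticOrderAt D a = (n + 1 : ℕ) :=
    hDan.analyticOrderAt_eq_natCast.2
      ⟨h, hhdiff.analyticAt a, hha, Filter.Eventually.of_forall hfactor⟩
  have hvanish : ∀ m < n + 1, iteratedDeriv m D a = 0 :=
    (natCast_le_analyticOrderAt_iff_iteratedDeriv_eq_zero hDan).1 horder.ge
  refine ⟨fun m hm => hvanish m (Nat.lt_succ_of_le hm), fun hlast => ?_, fun s hs => ?_⟩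
  · have : ((n + 2 : ℕ) : ℕ∞) ≤ analyticOrderAt D a :=
      (natCast_le_analyticOrderAt_iff_iteratedDeriv_eq_zero hDan).2 fun m hm => by
        rcases Nat.lt_succ_iff_lt_or_eq.1 hm with hm | rfl
        exacts [hvanish m hm, hlast]
    rw [horder, Nat.cast_le] at this
    omega
  · by_contra! hlt
    have hre : 0 < (δ * (s - a)).re := by
      rw [Complex.re_ofReal_mul, Complex.sub_re, ha, Complex.ofReal_re]
      exact mul_pos hδ (sub_pos.2 hlt)
    have hsa : s - a ≠ 0 := fun h0 => by simp [h0] at hre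
    rw [hfactor] at hs
    exact mul_ne_zero (pow_ne_zero _ hsa)
      (mul_ne_zero hδ' (laguerreKernel.integral_ne_zero hn hσ hone hpos hre)) hs
end

section
/- Let n ≥ 1, δ > 0, L = (l₁,…,lₙ) ∈ ℝⁿ, and let σ ∈ ℂ be such that D_δ^L and its first n complex derivatives all vanish at σ (i.e. σ is a zero of D_δ^L of multiplicity at least n+1). Then for all s ∈ ℂ, D_δ^L(s) = (1/n!)·(s−σ)^{n+1}·∫₀^δ q(σθ)·e^{−(s−σ)θ} dθ, where q(σθ) = Σ_{j=0}^{n} binom(n,j)·(n!/j!)·(σθ)^j. -/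
open Polynomial in
/-- A polynomial of degree at most `n` that factors through `(s - σ) ^ (n + 1)` near `σ`, with a
cofactor continuous at `σ`, is zero. -/
lemma Polynomial.eq_zero_of_eventually_eq_pow_mul {n : ℕ} {T : ℂ[X]} (hT : T.natDegree ≤ n)
    {σ : ℂ} {h : ℂ → ℂ} (hh : ContinuousAt h σ)
    (hTh : ∀ᶠ s in nhds σ, T.eval s = (s - σ) ^ (n + 1) * h s) : T = 0 := by
  by_contra hT0
  obtain ⟨R, hR, hndvd⟩ := exists_eq_pow_rootMultiplicity_mul_and_not_dvd T hT0 σ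
  set m := T.rootMultiplicity σ with hm_def
  have hm : m ≤ n := by
    have h1 : m ≤ T.roots.card := by
      rw [hm_def, ← count_roots]
      exact Multiset.count_le_card _ _
    exact h1.trans ((card_roots' T).trans hT)
  apply hndvd
  rw [dvd_iff_isRoot, IsRoot]
  have hev : ∀ᶠ s in nhdsWithin σ {σ}ᶜ, R.eval s = (s - σ) ^ (n - m + 1) * h s := by
    filter_upwards [nhdsWithin_le_nhds hTh, self_mem_nhdsWithin] with s hs hne
    have hne' : (s - σ) ^ m ≠ 0 := pow_ne_zero _ (sub_ne_zero.2 hne)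
    apply mul_left_cancel₀ hne'
    rw [hR, eval_mul, eval_pow, eval_sub, eval_X, eval_C] at hs
    rw [hs, ← mul_assoc, ← pow_add]
    congr 2
    omega
  have h1 : Filter.Tendsto (fun s => R.eval s) (nhdsWithin σ {σ}ᶜ) (nhds (R.eval σ)) :=
    R.continuous.continuousAt.tendsto.mono_left nhdsWithin_le_nhds
  have hcont : ContinuousAt (fun s => (s - σ) ^ (n - m + 1) * h s) σ := by fun_prop
  have h2 := hcont.tendsto.mono_left (nhdsWithin_le_nhds (s := {σ}ᶜ))
  simpa using tendsto_nhds_unique (h1.congr' hev) h2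

/-- One integration by parts of a polynomial against an exponential. -/
lemma Polynomial.mul_integral_eval_mul_exp (p : Polynomial ℂ) (u : ℂ) (δ : ℝ) :
    u * ∫ θ in (0 : ℝ)..δ, p.eval (θ : ℂ) * Complex.exp (-u * (θ : ℂ)) =
      p.eval 0 - p.eval (δ : ℂ) * Complex.exp (-u * δ) +
        ∫ θ in (0 : ℝ)..δ, p.derivative.eval (θ : ℂ) * Complex.exp (-u * (θ : ℂ)) := by
  have hp : ∀ x ∈ Set.uIcc (0 : ℝ) δ,
      HasDerivAt (fun θ : ℝ => p.eval (θ : ℂ)) (p.derivative.eval (x : ℂ)) x :=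
    fun x _ => (p.hasDerivAt (x : ℂ)).comp_ofReal
  have he : ∀ x ∈ Set.uIcc (0 : ℝ) δ,
      HasDerivAt (fun θ : ℝ => Complex.exp (-u * (θ : ℂ)))
        (Complex.exp (-u * (x : ℂ)) * (-u)) x := fun x _ => by
    simpa using (((hasDerivAt_id (x : ℂ)).const_mul (-u)).cexp).comp_ofReal
  have hparts := intervalIntegral.integral_mul_deriv_eq_deriv_mul hp he
    (Continuous.intervalIntegrable (by fun_prop) _ _)
    (Continuous.intervalIntegrable (by fun_prop) _ _)
  have hleft : ∫ θ in (0 : ℝ)..δ, p.eval (θ : ℂ) * (Complex.exp (-u * (θ : ℂ)) * (-u)) =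
      -(u * ∫ θ in (0 : ℝ)..δ, p.eval (θ : ℂ) * Complex.exp (-u * (θ : ℂ))) := by
    rw [← neg_mul, ← intervalIntegral.integral_const_mul]
    congr 1
    ext θ
    ring
  rw [hleft] at hparts
  simp only [Complex.ofReal_zero, mul_zero, Complex.exp_zero, mul_one] at hparts
  linear_combination -hparts

/-- Repeated integration by parts of a polynomial against an exponential. -/
lemma Polynomial.pow_mul_integral_eval_mul_exp (u : ℂ) (δ : ℝ) (N : ℕ) (p : Polynomial ℂ) :
    u ^ N * ∫ θ in (0 : ℝ)..δ, p.eval (θ : ℂ) * Complex.exp (-u * (θ : ℂ)) =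
      ∑ k ∈ Finset.range N, u ^ (N - 1 - k) * ((Polynomial.derivative^[k] p).eval 0 -
          (Polynomial.derivative^[k] p).eval (δ : ℂ) * Complex.exp (-u * δ)) +
        ∫ θ in (0 : ℝ)..δ,
          (Polynomial.derivative^[N] p).eval (θ : ℂ) * Complex.exp (-u * (θ : ℂ)) := by
  induction N generalizing p with
  | zero => simp
  | succ N ih =>
    rw [pow_succ, mul_assoc, p.mul_integral_eval_mul_exp, mul_add, ih p.derivative,
      Finset.sum_range_succ']
    simp only [Function.iterate_succ_apply, Function.iterate_zero_apply, Nat.add_sub_cancel,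
      Nat.sub_zero]
    have hexp : ∀ k, N - 1 - k = N - (k + 1) := fun k => by omega
    simp only [hexp]
    ring

/-- The polynomial `θ ↦ q (σ θ)`, where `q z = ∑ j ≤ n, (n choose j) (n! / j!) z ^ j`. -/
noncomputable def factorizationKernel (n : ℕ) (σ : ℂ) : Polynomial ℂ :=
  ∑ j ∈ Finset.range (n + 1),
    Polynomial.monomial j ((n.choose j : ℂ) * ((n.factorial : ℂ) / (j.factorial : ℂ)) * σ ^ j)

lemma eval_factorizationKernel (n : ℕ) (σ z : ℂ) :
    (factorizationKernel n σ).eval z = ∑ j ∈ Finset.range (n + 1),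
      (n.choose j : ℂ) * ((n.factorial : ℂ) / (j.factorial : ℂ)) * (σ * z) ^ j := by
  simp [factorizationKernel, Polynomial.eval_finsetSum, mul_pow, mul_assoc]

lemma natDegree_factorizationKernel_le (n : ℕ) (σ : ℂ) :
    (factorizationKernel n σ).natDegree ≤ n :=
  Polynomial.natDegree_sum_le_of_forall_le _ _ fun _ hj =>
    (Polynomial.natDegree_monomial_le _).trans (Nat.lt_succ_iff.1 (Finset.mem_range.1 hj))

lemma eval_zero_iterate_derivative_factorizationKernel {n k : ℕ} (hk : k ≤ n) (σ : ℂ) :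
    (Polynomial.derivative^[k] (factorizationKernel n σ)).eval 0 =
      n.factorial * (n.choose k * σ ^ k) := by
  have hk0 : (k.factorial : ℂ) ≠ 0 := Nat.cast_ne_zero.2 k.factorial_ne_zero
  rw [← Polynomial.coeff_zero_eq_eval_zero, Polynomial.coeff_iterate_derivative]
  simp only [factorizationKernel, Polynomial.finsetSum_coeff, Polynomial.coeff_monomial]
  rw [Finset.sum_ite_eq', if_pos (Finset.mem_range.2 (by omega))]
  simp only [zero_add, Nat.descFactorial_self, nsmul_eq_mul]
  field_simp

/-- The iterated integration by parts for `factorizationKernel`: its boundary term at `0` is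
`n! s ^ n`. -/
lemma pow_mul_integral_factorizationKernel (n : ℕ) (δ : ℝ) (σ s : ℂ) :
    (s - σ) ^ (n + 1) * ∫ θ in (0 : ℝ)..δ,
        (factorizationKernel n σ).eval (θ : ℂ) * Complex.exp (-(s - σ) * (θ : ℂ)) =
      n.factorial * s ^ n - (∑ k ∈ Finset.range (n + 1), (s - σ) ^ (n - k) *
        (Polynomial.derivative^[k] (factorizationKernel n σ)).eval (δ : ℂ)) *
          Complex.exp (-(s - σ) * δ) := by
  rw [Polynomial.pow_mul_integral_eval_mul_exp, Polynomial.iterate_derivative_eq_zero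
    (Nat.lt_succ_of_le (natDegree_factorizationKernel_le n σ))]
  have hpow : s ^ n = ∑ k ∈ Finset.range (n + 1), σ ^ k * (s - σ) ^ (n - k) * n.choose k := by
    rw [← add_pow, add_sub_cancel]
  rw [hpow, Finset.mul_sum, Finset.sum_mul, ← Finset.sum_sub_distrib]
  simp only [Polynomial.eval_zero, zero_mul, intervalIntegral.integral_zero, add_zero,
    Nat.add_sub_cancel]
  refine Finset.sum_congr rfl fun k hk => ?_
  rw [eval_zero_iterate_derivative_factorizationKernel (Nat.lt_succ_iff.1 (Finset.mem_range.1 hk))]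
  ring


/-- integral factorization: if `σ` is a zero of multiplicity at least
`n+1` of the quasipolynomial `D_δ^L(s) = s^n + (l₁ s^{n−1} + ⋯ + lₙ) e^{−δs}` (i.e.
`D` and its first `n` derivatives vanish at `σ`), then for all `s ∈ ℂ`,
`D(s) = (1/n!)(s−σ)^{n+1} ∫₀^δ q(σθ) e^{−(s−σ)θ} dθ`,
with `q(z) = Σ_{j=0}^{n} binom(n,j)(n!/j!) z^j`. -/
theorem quasipolynomial_integral_factorization
    (n : ℕ) (hn : 1 ≤ n) (δ : ℝ) (hδ : 0 < δ)
    (L : Fin n → ℝ)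
    (D : ℂ → ℂ)
    (hD : ∀ s : ℂ, D s =
      s ^ n + (∑ k : Fin n, (L k : ℂ) * s ^ (n - 1 - (k : ℕ))) * Complex.exp (-(δ : ℂ) * s))
    (σ : ℂ)
    (hmult : ∀ m ≤ n, iteratedDeriv m D σ = 0) :
    ∀ s : ℂ, D s = (1 / (n.factorial : ℂ)) * (s - σ) ^ (n + 1) *
      ∫ θ in (0 : ℝ)..δ,
        (∑ j ∈ Finset.range (n + 1),
          (n.choose j : ℂ) * ((n.factorial : ℂ) / (j.factorial : ℂ)) * (σ * (θ : ℂ)) ^ j) *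
        Complex.exp (-(s - σ) * (θ : ℂ)) := by
  have hn0 : (n.factorial : ℂ) ≠ 0 := Nat.cast_ne_zero.2 n.factorial_ne_zero
  simp only [← eval_factorizationKernel]
  set p := factorizationKernel n σ with hp
  set I : ℂ → ℂ := fun s => ∫ θ in (0 : ℝ)..δ,
    p.eval (θ : ℂ) * Complex.exp (-(s - σ) * (θ : ℂ)) with hI
  have hIcont : Continuous I :=
    intervalIntegral.continuous_parametric_intervalIntegral_of_continuous'
      (by simp only [Function.uncurry_def]; fun_prop) _ _
  let T : Polynomial ℂ :=
    Polynomial.C (n.factorial : ℂ) *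
        ∑ k : Fin n, Polynomial.C (L k : ℂ) * Polynomial.X ^ (n - 1 - (k : ℕ)) +
      Polynomial.C (Complex.exp (δ * σ)) * ∑ k ∈ Finset.range (n + 1),
        (Polynomial.X - Polynomial.C σ) ^ (n - k) *
          Polynomial.C ((Polynomial.derivative^[k] p).eval (δ : ℂ))
  have hTdeg : T.natDegree ≤ n := by
    refine Polynomial.natDegree_add_le_of_degree_le
      ((Polynomial.natDegree_C_mul_le _ _).trans
        (Polynomial.natDegree_sum_le_of_forall_le _ _ fun k _ => ?_))
      ((Polynomial.natDegree_C_mul_le _ _).trans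
        (Polynomial.natDegree_sum_le_of_forall_le _ _ fun k _ => ?_))
    · exact (Polynomial.natDegree_C_mul_X_pow_le _ _).trans (by omega)
    · refine (Polynomial.natDegree_mul_C_le _ _).trans ?_
      rw [Polynomial.natDegree_pow, Polynomial.natDegree_X_sub_C]
      omega
  have hTeval : ∀ s, T.eval s =
      Complex.exp (δ * s) * (n.factorial * D s - (s - σ) ^ (n + 1) * I s) := by
    intro s
    have h1 : Complex.exp (δ * s) * Complex.exp (-δ * s) = 1 := by
      rw [← Complex.exp_add]
      simp
    have h2 : Complex.exp (δ * s) * Complex.exp (-(s - σ) * δ) = Complex.exp (δ * σ) := by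
      rw [← Complex.exp_add]
      ring_nf
    rw [hD, hI, pow_mul_integral_factorizationKernel]
    simp only [T, Polynomial.eval_add, Polynomial.eval_mul, Polynomial.eval_finsetSum,
      Polynomial.eval_C, Polynomial.eval_pow, Polynomial.eval_X, Polynomial.eval_sub]
    rw [← h2]
    linear_combination (-(n.factorial : ℂ) * ∑ k : Fin n, (L k : ℂ) * s ^ (n - 1 - (k : ℕ))) * h1
  have hDan : AnalyticAt ℂ D σ := by
    rw [funext hD]
    fun_prop
  obtain ⟨g, hg, hDg⟩ := (natCast_le_analyticOrderAt hDan).1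
    ((natCast_le_analyticOrderAt_iff_iteratedDeriv_eq_zero hDan (n := n + 1)).2
      fun i hi => hmult i (Nat.lt_succ_iff.1 hi))
  have hT : T = 0 := by
    have hgc := hg.continuousAt
    refine Polynomial.eq_zero_of_eventually_eq_pow_mul hTdeg (σ := σ)
      (h := fun s => Complex.exp (δ * s) * (n.factorial * g s - I s)) (by fun_prop) ?_
    filter_upwards [hDg] with s hs
    rw [hTeval, hs, smul_eq_mul]
    ring
  intro s
  have hs := hTeval s
  rw [hT, Polynomial.eval_zero, eq_comm, mul_eq_zero, or_iff_right (Complex.exp_ne_zero _)] at hs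
  change D s = 1 / (n.factorial : ℂ) * (s - σ) ^ (n + 1) * I s
  field_simp
  linear_combination hs
end

section
/- Let n ≥ 1, h > 0, γ_m > 0, and A, A₁ ∈ ℝ^{n×n}. Suppose there exist symmetric positive definite matrices P, R, S ∈ ℝ^{n×n} and matrices P₂, P₃, P₄ ∈ ℝ^{n×n} such that the symmetric 4n×4n block matrix W is negative definite, where the blocks of W are: W₁₁ = AᵀP₂ + P₂ᵀA + S − R + γ_m²Iₙ, W₁₂ = P − P₂ᵀ + AᵀP₃, W₁₃ = P₂ᵀA₁ + R, W₁₄ = P₂ᵀ + AᵀP₄, W₂₂ = −P₃ − P₃ᵀ + h²R, W₂₃ = P₃ᵀA₁, W₂₄ = P₃ᵀ − P₄, W₃₃ = −S − R, W₃₄ = A₁ᵀP₄, W₄₄ = P₄ᵀ + P₄ − Iₙ, and W_{ji} = W_{ij}ᵀ for j > i. Then for every function κ : ℝⁿ × ℝ → ℝⁿ with ‖κ(ξ,t)‖ ≤ γ_m‖ξ‖ for all ξ ∈ ℝⁿ, t ∈ ℝ, and every continuous e : [−h,∞) → ℝⁿ that is differentiable on (0,∞) and satisfies ė(t) = A·e(t)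 + A₁·e(t−h) + κ(e(t),t) for all t > 0, one has e(t) → 0 as t → +∞. -/
open Matrix

open MeasureTheory Filter Topology Set
open scoped RealInnerProductSpace

theorem intervalIntegrable_comp_of_bounded {E F : Type*} [NormedAddCommGroup E] [ProperSpace E]
    [NormedAddCommGroup F] {Φ : E → E → F} (hΦ : Continuous fun p : E × E => Φ p.1 p.2)
    {e v : ℝ → E} {a b C : ℝ} (hab : a ≤ b) (he : ContinuousOn e (Icc a b)) (hv : StronglyMeasurable v)
    (hC : ∀ t ∈ Icc a b, ‖v t‖ ≤ C) :
    IntervalIntegrable (fun t => Φ (e t) (v t)) volume a b := by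
  obtain ⟨K, hK⟩ := isCompact_Icc.exists_bound_of_continuousOn he
  obtain ⟨M, hM⟩ := ((isCompact_closedBall (0 : E) K).prod
    (isCompact_closedBall (0 : E) C)).exists_bound_of_continuousOn hΦ.continuousOn
  rw [intervalIntegrable_iff_integrableOn_Icc_of_le hab]
  refine Integrable.of_bound (C := M) ?_ ?_
  · exact hΦ.comp_aestronglyMeasurable
      ((he.aestronglyMeasurable measurableSet_Icc).prodMk hv.aestronglyMeasurable)
  · filter_upwards [ae_restrict_mem measurableSet_Icc] with t ht
    exact hM (e t, v t) ⟨by simpa using hK t ht, by simpa using hC t ht⟩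

theorem integral_sub_comp_sub_right {f : ℝ → ℝ} {h T : ℝ} (hh : 0 < h) (hT : 2 * h ≤ T)
    (hf : ContinuousOn f (Ici h)) :
    ∫ t in (2 * h)..T, (f t - f (t - h)) = (∫ t in (T - h)..T, f t) - ∫ t in h..(2 * h), f t := by
  have hi : ∀ {a b}, h ≤ a → h ≤ b → IntervalIntegrable f volume a b := fun ha hb =>
    (hf.mono fun x hx => (le_min ha hb).trans hx.1).intervalIntegrable
  rw [intervalIntegral.integral_sub (hi (by linarith) (by linarith)),
    intervalIntegral.integral_comp_sub_right,
    intervalIntegral.integral_interval_sub_interval_comm' (hi _ _) (hi _ _) (hi _ _)]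
  · congr 2; ring
  all_goals try linarith
  refine ContinuousOn.intervalIntegrable ?_
  refine hf.comp (by fun_prop) fun x hx => ?_
  rw [uIcc_of_le hT] at hx
  simp only [mem_Ici]
  linarith [hx.1]

section Lyapunov

variable {E : Type*} [NormedAddCommGroup E] [InnerProductSpace ℝ E]

/-- Jensen's inequality for the quadratic form of a nonnegative symmetric operator. -/
theorem inner_sub_le_mul_integral_inner {R : E →L[ℝ] E} (hRs : ∀ x y, ⟪R x, y⟫ = ⟪x, R y⟫)
    (hR : ∀ x, 0 ≤ ⟪x, R x⟫) {e v : ℝ → E} {a b : ℝ} (hab : a < b)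
    (he : ∀ t ∈ Icc a b, HasDerivAt e (v t) t)
    (hv : IntervalIntegrable v volume a b)
    (hq : IntervalIntegrable (fun t => ⟪v t, R (v t)⟫) volume a b) :
    ⟪e b - e a, R (e b - e a)⟫ ≤ (b - a) * ∫ t in a..b, ⟪v t, R (v t)⟫ := by
  have hba : 0 < b - a := sub_pos.2 hab
  set m := e b - e a
  set L : E →L[ℝ] ℝ := innerSL ℝ (R m) with hL
  have hLe : ∀ x, L x = ⟪m, R x⟫ := fun x => by rw [hL, innerSL_apply_apply, hRs]
  have hLv : IntervalIntegrable (fun t => L (v t)) volume a b :=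
    ⟨L.integrable_comp hv.1, L.integrable_comp hv.2⟩
  have hint : ∫ t in a..b, L (v t) = L m := by
    rw [intervalIntegral.integral_eq_sub_of_hasDerivAt (f := fun t => L (e t)), ← map_sub]
    · rw [uIcc_of_le hab.le]
      exact fun t ht => L.hasFDerivAt.comp_hasDerivAt t (he t ht)
    · exact hLv
  have hpt : ∀ t, 2 * (b - a) * L (v t) - L m ≤ (b - a) ^ 2 * ⟪v t, R (v t)⟫ := by
    intro t
    have h1 := hR ((b - a) • v t - m)
    have h2 : ⟪v t, R m⟫ = L (v t) := by rw [real_inner_comm]; rfl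
    simp only [map_sub, map_smul, inner_sub_left, inner_sub_right, inner_smul_left,
      inner_smul_right, conj_trivial, h2] at h1
    rw [hLe] at *
    rw [hLe]
    nlinarith
  have hmono := intervalIntegral.integral_mono_on hab.le
    ((hLv.const_mul (2 * (b - a))).sub (intervalIntegrable_const (c := L m)))
    (hq.const_mul ((b - a) ^ 2)) (fun t _ => hpt t)
  rw [intervalIntegral.integral_sub (hLv.const_mul _) intervalIntegrable_const,
    intervalIntegral.integral_const_mul, intervalIntegral.integral_const_mul, hint,
    intervalIntegral.integral_const, smul_eq_mul] at hmono
  rw [← hLe]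
  refine le_of_mul_le_mul_left ?_ hba
  nlinarith

theorem tendsto_zero_of_integral_sq_bounded {e v : ℝ → E} {s C : ℝ}
    (he : ∀ t, s ≤ t → HasDerivAt e (v t) t) (hv : StronglyMeasurable v)
    (hi : ∀ T, s ≤ T → IntervalIntegrable (fun t => ‖e t‖ ^ 2 + ‖v t‖ ^ 2) volume s T)
    (hC : ∀ T, s ≤ T → ∫ t in s..T, (‖e t‖ ^ 2 + ‖v t‖ ^ 2) ≤ C) :
    Tendsto e atTop (𝓝 0) := by
  have hec : ContinuousOn e (Ioi s) :=
    fun t ht => (he t (le_of_lt ht)).continuousAt.continuousWithinAt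
  have hsum : IntegrableOn (fun t => ‖e t‖ ^ 2 + ‖v t‖ ^ 2) (Ioi s) := by
    refine integrableOn_Ioi_of_intervalIntegral_norm_bounded (b := fun T : ℝ => max s T)
      (l := atTop) C s (fun T => ?_) ?_ ?_
    · exact (intervalIntegrable_iff_integrableOn_Ioc_of_le (le_max_left _ _)).1
        (hi _ (le_max_left _ _))
    · exact tendsto_atTop_mono (fun T => le_max_right s T) tendsto_id
    · refine Eventually.of_forall fun T => ?_
      convert hC _ (le_max_left s T) using 3 with t
      exact Real.norm_of_nonneg (by positivity)
  have hem : AEStronglyMeasurable e (volume.restrict (Ioi s)) :=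
    hec.aestronglyMeasurable measurableSet_Ioi
  have hsq : Tendsto (fun t => ‖e t‖ ^ 2) atTop (𝓝 0) := by
    refine tendsto_zero_of_hasDerivAt_of_integrableOn_Ioi (a := s)
      (fun t ht => (he t (le_of_lt ht)).norm_sq) ?_ ?_
    · refine hsum.mono' ((hem.inner hv.aestronglyMeasurable).const_mul 2)
        (Eventually.of_forall fun t => ?_)
      have := abs_real_inner_le_norm (e t) (v t)
      rw [norm_mul, Real.norm_eq_abs, Real.norm_eq_abs, abs_two]
      nlinarith [sq_nonneg (‖e t‖ - ‖v t‖)]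
    · refine hsum.mono' (hem.norm.pow 2) (Eventually.of_forall fun t => ?_)
      rw [Real.norm_of_nonneg (by positivity)]
      nlinarith [sq_nonneg ‖v t‖]
  rw [tendsto_zero_iff_norm_tendsto_zero]
  simpa using hsq.sqrt

/-- Lyapunov–Krasovskii criterion: if the dissipation inequality coming from the functional
`⟪e, P e⟫ + ∫ ⟪e, S e⟫ + h ∬ ⟪e', R e'⟫` is strict, then `e` tends to zero. -/
theorem tendsto_zero_of_lyapunovKrasovskii [ProperSpace E] {P R S : E →L[ℝ] E}
    (hPs : ∀ x y, ⟪P x, y⟫ = ⟪x, P y⟫) (hP : ∀ x, 0 ≤ ⟪x, P x⟫)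
    (hRs : ∀ x y, ⟪R x, y⟫ = ⟪x, R y⟫) (hR : ∀ x, 0 ≤ ⟪x, R x⟫) (hS : ∀ x, 0 ≤ ⟪x, S x⟫)
    {e v : ℝ → E} {h ε : ℝ} (hh : 0 < h) (hε : 0 < ε)
    (he : ∀ t, 0 < t → HasDerivAt e (v t) t) (hv : StronglyMeasurable v)
    (hbdd : ∀ b, ∃ C, ∀ t ∈ Icc h b, ‖v t‖ ≤ C)
    (hdiss : ∀ t, 2 * h ≤ t →
      2 * ⟪e t, P (v t)⟫ + (⟪e t, S (e t)⟫ - ⟪e (t - h), S (e (t - h))⟫)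
        + h ^ 2 * ⟪v t, R (v t)⟫ - ⟪e t - e (t - h), R (e t - e (t - h))⟫
        ≤ -ε * (‖e t‖ ^ 2 + ‖v t‖ ^ 2)) :
    Tendsto e atTop (𝓝 0) := by
  have hec : ContinuousOn e (Ici h) :=
    fun t ht => (he t (hh.trans_le ht)).continuousAt.continuousWithinAt
  have hint : ∀ {Φ : E → E → ℝ}, (Continuous fun p : E × E => Φ p.1 p.2) →
      ∀ {a b : ℝ}, h ≤ a → a ≤ b → IntervalIntegrable (fun t => Φ (e t) (v t)) volume a b := by
    intro Φ hΦ a b ha hab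
    obtain ⟨C, hC⟩ := hbdd b
    exact intervalIntegrable_comp_of_bounded hΦ hab (hec.mono fun x hx => ha.trans hx.1) hv
      fun t ht => hC t ⟨ha.trans ht.1, ht.2⟩
  have hvi : ∀ {a b : ℝ}, h ≤ a → a ≤ b → IntervalIntegrable v volume a b := by
    intro a b ha hab
    obtain ⟨C, hC⟩ := hbdd b
    exact intervalIntegrable_comp_of_bounded (Φ := fun _ y => y) (by fun_prop) hab
      (hec.mono fun x hx => ha.trans hx.1) hv fun t ht => hC t ⟨ha.trans ht.1, ht.2⟩
  set q : ℝ → ℝ := fun t => ⟪v t, R (v t)⟫ with hq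
  set σ : ℝ → ℝ := fun t => ⟪e t, S (e t)⟫ with hσ
  set F : ℝ → ℝ := fun t => ∫ τ in h..t, q τ with hF
  have hqi : ∀ {a b : ℝ}, h ≤ a → a ≤ b → IntervalIntegrable q volume a b :=
    hint (Φ := fun _ y => ⟪y, R y⟫) (by fun_prop)
  have hni : ∀ {a b : ℝ}, h ≤ a → a ≤ b →
      IntervalIntegrable (fun t => ‖e t‖ ^ 2 + ‖v t‖ ^ 2) volume a b :=
    hint (Φ := fun x y => ‖x‖ ^ 2 + ‖y‖ ^ 2) (by fun_prop)
  have hpi : ∀ {a b : ℝ}, h ≤ a → a ≤ b →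
      IntervalIntegrable (fun t => 2 * ⟪e t, P (v t)⟫) volume a b :=
    hint (Φ := fun x y => 2 * ⟪x, P y⟫) (by fun_prop)
  have hσc : ContinuousOn σ (Ici h) := hec.inner (S.continuous.comp_continuousOn hec)
  have hFsub : ∀ {a b : ℝ}, h ≤ a → a ≤ b → F b - F a = ∫ t in a..b, q t := fun ha hab =>
    intervalIntegral.integral_interval_sub_left (hqi le_rfl (ha.trans hab)) (hqi le_rfl ha)
  have hFmono : ∀ {a b : ℝ}, h ≤ a → a ≤ b → F a ≤ F b := fun ha hab => by
    rw [← sub_nonneg, hFsub ha hab]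
    exact intervalIntegral.integral_nonneg hab fun t _ => hR _
  have hFc : ContinuousOn F (Ici h) := by
    intro t ht
    have := intervalIntegral.continuousOn_primitive_interval' (hqi le_rfl
      (show h ≤ t + 1 by linarith [mem_Ici.1 ht])) left_mem_uIcc
    rw [uIcc_of_le (by linarith [mem_Ici.1 ht])] at this
    refine (this t ⟨ht, by linarith⟩).mono_of_mem_nhdsWithin ?_
    rw [← Ici_inter_Iic]
    exact inter_mem self_mem_nhdsWithin (mem_nhdsWithin_of_mem_nhds (Iic_mem_nhds (by linarith)))
  refine tendsto_zero_of_integral_sq_bounded (s := 2 * h)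
    (C := (⟪e (2 * h), P (e (2 * h))⟫ + (∫ t in h..(2 * h), σ t) + h ^ 2 * F (2 * h)
      - h * ∫ t in h..(2 * h), F t) / ε)
    (fun t ht => he t (by linarith)) hv (fun T hT => hni (by linarith) hT) fun T hT => ?_
  have hpt : ∀ t ∈ Icc (2 * h) T, ε * (‖e t‖ ^ 2 + ‖v t‖ ^ 2) ≤
      h * (F t - F (t - h)) - (2 * ⟪e t, P (v t)⟫ + (σ t - σ (t - h)) + h ^ 2 * q t) := by
    intro t ht
    have h1 := hdiss t ht.1
    have h2 := inner_sub_le_mul_integral_inner hRs hR (sub_lt_self t hh)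
      (fun τ hτ => he τ (by linarith [hτ.1, ht.1])) (hvi (by linarith [ht.1]) (by linarith))
      (hqi (by linarith [ht.1]) (by linarith))
    rw [← hFsub (by linarith [ht.1]) (by linarith), sub_sub_cancel] at h2
    simp only [hσ, hq] at *
    linarith
  have hdi : ∀ {f : ℝ → ℝ}, ContinuousOn f (Ici h) →
      IntervalIntegrable (fun t => f t - f (t - h)) volume (2 * h) T := by
    intro f hf
    refine ContinuousOn.intervalIntegrable ?_
    rw [uIcc_of_le hT]
    refine (hf.mono fun x hx => ?_).sub (hf.comp (by fun_prop) fun x hx => ?_) <;>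
    · simp only [mem_Ici]
      linarith [hx.1]
  have hs : h ≤ 2 * h := by linarith
  have hmono := intervalIntegral.integral_mono_on hT ((hni hs hT).const_mul ε)
    (((hdi hFc).const_mul h).sub
      (((hpi hs hT).add (hdi hσc)).add ((hqi hs hT).const_mul (h ^ 2)))) hpt
  rw [intervalIntegral.integral_sub ((hdi hFc).const_mul h)
      (((hpi hs hT).add (hdi hσc)).add ((hqi hs hT).const_mul (h ^ 2))),
    intervalIntegral.integral_add ((hpi hs hT).add (hdi hσc)) ((hqi hs hT).const_mul (h ^ 2)),
    intervalIntegral.integral_add (hpi hs hT) (hdi hσc),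
    intervalIntegral.integral_const_mul ε, intervalIntegral.integral_const_mul h,
    intervalIntegral.integral_const_mul (h ^ 2), integral_sub_comp_sub_right hh hT hFc,
    integral_sub_comp_sub_right hh hT hσc, ← hFsub hs hT] at hmono
  have hPint : ∫ t in (2 * h)..T, 2 * ⟪e t, P (v t)⟫
      = ⟪e T, P (e T)⟫ - ⟪e (2 * h), P (e (2 * h))⟫ := by
    refine intervalIntegral.integral_eq_sub_of_hasDerivAt (f := fun t => ⟪e t, P (e t)⟫)
      (fun t ht => ?_) (hpi hs hT)
    rw [uIcc_of_le hT] at ht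
    have hd := he t (by linarith [ht.1])
    refine (hd.inner ℝ (P.hasFDerivAt.comp_hasDerivAt t hd)).congr_deriv ?_
    rw [Function.comp_apply, ← hPs (v t) (e t), real_inner_comm (e t) (P (v t))]
    ring
  have hσpos : 0 ≤ ∫ t in (T - h)..T, σ t :=
    intervalIntegral.integral_nonneg (by linarith) fun t _ => hS _
  have hFle : ∫ t in (T - h)..T, F t ≤ h * F T := by
    have := intervalIntegral.integral_mono_on (μ := volume) (a := T - h) (b := T) (f := F)
      (g := fun _ => F T) (by linarith)
      (hFc.mono fun x hx => ?_).intervalIntegrable intervalIntegrable_const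
      (fun t ht => hFmono (by linarith [ht.1]) ht.2)
    · simpa using this
    · rw [uIcc_of_le (by linarith)] at hx
      simp only [mem_Ici]
      linarith [hx.1]
  have hPT := hP (e T)
  rw [le_div_iff₀ hε]
  rw [hPint] at hmono
  nlinarith [mul_le_mul_of_nonneg_left hFle hh.le]

end Lyapunov

/-- A continuous function, homogeneous of degree two and negative away from the origin, is
bounded above by a negative multiple of the squared norm. -/
theorem exists_le_neg_mul_sq_norm {E : Type*} [NormedAddCommGroup E] [NormedSpace ℝ E]
    [ProperSpace E] {Q : E → ℝ} (hQ : Continuous Q) (hhom : ∀ (r : ℝ) x, Q (r • x) = r ^ 2 * Q x)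
    (hneg : ∀ x, x ≠ 0 → Q x < 0) : ∃ ε > 0, ∀ x, Q x ≤ -ε * ‖x‖ ^ 2 := by
  have h0 : Q 0 = 0 := by simpa using hhom 0 0
  rcases (Metric.sphere (0 : E) 1).eq_empty_or_nonempty with hs | hs
  · refine ⟨1, one_pos, fun x => ?_⟩
    have hx : x = 0 := by
      by_contra hx
      have : ‖x‖⁻¹ • x ∈ Metric.sphere (0 : E) 1 := by simp [norm_smul, hx]
      simp [hs] at this
    simp [hx, h0]
  · obtain ⟨y, hy, hmax⟩ := (isCompact_sphere (0 : E) 1).exists_isMaxOn hs hQ.continuousOn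
    have hy0 : y ≠ 0 := ne_zero_of_mem_unit_sphere ⟨y, hy⟩
    refine ⟨-Q y, neg_pos.2 (hneg y hy0), fun x => ?_⟩
    rcases eq_or_ne x 0 with rfl | hx
    · simp [h0]
    · have hmem : ‖x‖⁻¹ • x ∈ Metric.sphere (0 : E) 1 := by simp [norm_smul, hx]
      have h1 : Q (‖x‖⁻¹ • x) ≤ Q y := hmax hmem
      have h2 : Q x = ‖x‖ ^ 2 * Q (‖x‖⁻¹ • x) := by
        rw [← hhom, smul_inv_smul₀ (norm_ne_zero_iff.2 hx)]
      rw [h2, neg_neg, mul_comm]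
      exact mul_le_mul_of_nonneg_right h1 (by positivity)

/-- The quadratic form of the block matrix in `lmi_gain_margin_convergence`, in descriptor form. -/
theorem lmi_quadratic_form_eq {n : ℕ} (h γm : ℝ) (A A₁ P R S P₂ P₃ P₄ : Matrix (Fin n) (Fin n) ℝ)
    (hRs : Rᵀ = R) (a b c d : Fin n → ℝ) :
    a ⬝ᵥ (Aᵀ * P₂ + P₂ᵀ * A + S - R + γm ^ 2 • (1 : Matrix (Fin n) (Fin n) ℝ)).mulVec a
      + 2 * (a ⬝ᵥ (P - P₂ᵀ + Aᵀ * P₃).mulVec b)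
      + 2 * (a ⬝ᵥ (P₂ᵀ * A₁ + R).mulVec c)
      + 2 * (a ⬝ᵥ (P₂ᵀ + Aᵀ * P₄).mulVec d)
      + b ⬝ᵥ (-P₃ - P₃ᵀ + h ^ 2 • R).mulVec b
      + 2 * (b ⬝ᵥ (P₃ᵀ * A₁).mulVec c)
      + 2 * (b ⬝ᵥ (P₃ᵀ - P₄).mulVec d)
      + c ⬝ᵥ (-S - R).mulVec c
      + 2 * (c ⬝ᵥ (A₁ᵀ * P₄).mulVec d)
      + d ⬝ᵥ (P₄ᵀ + P₄ - (1 : Matrix (Fin n) (Fin n) ℝ)).mulVec d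
    = 2 * (a ⬝ᵥ P *ᵥ b) + (a ⬝ᵥ S *ᵥ a - c ⬝ᵥ S *ᵥ c) + h ^ 2 * (b ⬝ᵥ R *ᵥ b)
      - (a - c) ⬝ᵥ R *ᵥ (a - c) + (γm ^ 2 * (a ⬝ᵥ a) - d ⬝ᵥ d)
      + 2 * ((P₂ *ᵥ a + P₃ *ᵥ b + P₄ *ᵥ d) ⬝ᵥ (A *ᵥ a + A₁ *ᵥ c + d - b)) := by
  have hT : ∀ (M : Matrix (Fin n) (Fin n) ℝ) (x y : Fin n → ℝ),
      x ⬝ᵥ Mᵀ *ᵥ y = (M *ᵥ x) ⬝ᵥ y := fun M x y => by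
    rw [mulVec_transpose, dotProduct_comm, ← dotProduct_mulVec, dotProduct_comm]
  have hR : c ⬝ᵥ R *ᵥ a = a ⬝ᵥ R *ᵥ c := by
    conv_lhs => rw [← hRs, hT, dotProduct_comm]
  simp only [add_mulVec, sub_mulVec, neg_mulVec, smul_mulVec, one_mulVec, ← mulVec_mulVec,
    dotProduct_add, dotProduct_sub, dotProduct_neg, dotProduct_smul, add_dotProduct,
    sub_dotProduct, mulVec_sub, hT, hR, smul_eq_mul]
  rw [dotProduct_comm (A *ᵥ a) (P₂ *ᵥ a), dotProduct_comm (A *ᵥ a) (P₃ *ᵥ b),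
    dotProduct_comm (A *ᵥ a) (P₄ *ᵥ d), dotProduct_comm (A₁ *ᵥ c) (P₄ *ᵥ d),
    dotProduct_comm b (P₃ *ᵥ b), dotProduct_comm b (P₄ *ᵥ d), dotProduct_comm d (P₄ *ᵥ d)]
  ring

/-- LMI gain margin: if there exist `P, R, S ≻ 0` and `P₂, P₃, P₄` making
the symmetric 4n×4n block matrix `W` (with the blocks listed in the paper) negative
definite — expressed here by negativity of the associated quadratic form
`xᵀWx < 0` for `x = (a,b,c,d) ≠ 0` — then every solution of the perturbed linear delay
equation `ė(t) = A e(t) + A₁ e(t−h) + κ(e(t),t)`, with any perturbation of linear gain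
`‖κ(ξ,t)‖ ≤ γ_m ‖ξ‖`, converges to zero. -/
theorem lmi_gain_margin_convergence
    (n : ℕ) (hn : 1 ≤ n) (h γm : ℝ) (hh : 0 < h) (hγm : 0 < γm)
    (A A₁ : Matrix (Fin n) (Fin n) ℝ)
    (P R S P₂ P₃ P₄ : Matrix (Fin n) (Fin n) ℝ)
    (hP : P.PosDef) (hR : R.PosDef) (hS : S.PosDef)
    (hW : ∀ a b c d : Fin n → ℝ, ¬(a = 0 ∧ b = 0 ∧ c = 0 ∧ d = 0) →
        a ⬝ᵥ (Aᵀ * P₂ + P₂ᵀ * A + S - R + γm ^ 2 • (1 : Matrix (Fin n) (Fin n) ℝ)).mulVec a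
      + 2 * (a ⬝ᵥ (P - P₂ᵀ + Aᵀ * P₃).mulVec b)
      + 2 * (a ⬝ᵥ (P₂ᵀ * A₁ + R).mulVec c)
      + 2 * (a ⬝ᵥ (P₂ᵀ + Aᵀ * P₄).mulVec d)
      + b ⬝ᵥ (-P₃ - P₃ᵀ + h ^ 2 • R).mulVec b
      + 2 * (b ⬝ᵥ (P₃ᵀ * A₁).mulVec c)
      + 2 * (b ⬝ᵥ (P₃ᵀ - P₄).mulVec d)
      + c ⬝ᵥ (-S - R).mulVec c
      + 2 * (c ⬝ᵥ (A₁ᵀ * P₄).mulVec d)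
      + d ⬝ᵥ (P₄ᵀ + P₄ - (1 : Matrix (Fin n) (Fin n) ℝ)).mulVec d < 0)
    (κ : EuclideanSpace ℝ (Fin n) → ℝ → EuclideanSpace ℝ (Fin n))
    (hκ : ∀ (ξ : EuclideanSpace ℝ (Fin n)) (t : ℝ), ‖κ ξ t‖ ≤ γm * ‖ξ‖)
    (e : ℝ → EuclideanSpace ℝ (Fin n))
    (hecont : ContinuousOn e (Set.Ici (-h)))
    (hede : ∀ t : ℝ, 0 < t → HasDerivAt e
      ((WithLp.equiv 2 (Fin n → ℝ)).symm (A.mulVec (e t))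
        + (WithLp.equiv 2 (Fin n → ℝ)).symm (A₁.mulVec (e (t - h)))
        + κ (e t) t) t) :
    Filter.Tendsto e Filter.atTop (nhds 0) := by
  let L := fun M : Matrix (Fin n) (Fin n) ℝ => toEuclideanCLM (𝕜 := ℝ) M
  have hL : ∀ M (x y : EuclideanSpace ℝ (Fin n)), ⟪x, L M y⟫ = x.ofLp ⬝ᵥ M *ᵥ y.ofLp :=
    inner_toEuclideanCLM
  have hsymm : ∀ M : Matrix (Fin n) (Fin n) ℝ, M.PosDef → Mᵀ = M := fun M hM => by
    simpa [IsHermitian] using hM.1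
  have hLs : ∀ M : Matrix (Fin n) (Fin n) ℝ, M.PosDef → ∀ x y, ⟪L M x, y⟫ = ⟪x, L M y⟫ := by
    intro M hM x y
    rw [real_inner_comm, hL, hL, dotProduct_mulVec, ← mulVec_transpose, hsymm M hM,
      dotProduct_comm]
  have hLpos : ∀ M : Matrix (Fin n) (Fin n) ℝ, M.PosDef → ∀ x, 0 ≤ ⟪x, L M x⟫ := by
    intro M hM x
    rw [hL]
    simpa using hM.posSemidef.dotProduct_mulVec_nonneg x.ofLp
  have hdot : ∀ x : EuclideanSpace ℝ (Fin n), x.ofLp ⬝ᵥ x.ofLp = ‖x‖ ^ 2 := fun x => by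
    rw [← real_inner_self_eq_norm_sq, EuclideanSpace.inner_eq_star_dotProduct]
    simp
  simp only [lmi_quadratic_form_eq h γm A A₁ P R S P₂ P₃ P₄ (hsymm R hR)] at hW
  obtain ⟨ε, hε, hQ⟩ := exists_le_neg_mul_sq_norm (E := EuclideanSpace ℝ (Fin n) ×
      EuclideanSpace ℝ (Fin n) × EuclideanSpace ℝ (Fin n) × EuclideanSpace ℝ (Fin n))
    (Q := fun x =>
      2 * (x.1.ofLp ⬝ᵥ P *ᵥ x.2.1.ofLp)
        + (x.1.ofLp ⬝ᵥ S *ᵥ x.1.ofLp - x.2.2.1.ofLp ⬝ᵥ S *ᵥ x.2.2.1.ofLp)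
        + h ^ 2 * (x.2.1.ofLp ⬝ᵥ R *ᵥ x.2.1.ofLp)
        - (x.1.ofLp - x.2.2.1.ofLp) ⬝ᵥ R *ᵥ (x.1.ofLp - x.2.2.1.ofLp)
        + (γm ^ 2 * (x.1.ofLp ⬝ᵥ x.1.ofLp) - x.2.2.2.ofLp ⬝ᵥ x.2.2.2.ofLp)
        + 2 * ((P₂ *ᵥ x.1.ofLp + P₃ *ᵥ x.2.1.ofLp + P₄ *ᵥ x.2.2.2.ofLp) ⬝ᵥ
          (A *ᵥ x.1.ofLp + A₁ *ᵥ x.2.2.1.ofLp + x.2.2.2.ofLp - x.2.1.ofLp)))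
    (by fun_prop)
    (fun r x => by
      simp only [Prod.smul_fst, Prod.smul_snd, WithLp.ofLp_smul, mulVec_smul, ← smul_add,
        ← smul_sub, dotProduct_smul, smul_dotProduct, smul_eq_mul]
      ring)
    (fun x hx => hW _ _ _ _ fun h0 => hx <| by
      simpa [Prod.ext_iff] using h0)
  have hd : ∀ t, 0 < t → HasDerivAt e (deriv e t) t := fun t ht =>
    (hede t ht).differentiableAt.hasDerivAt
  refine tendsto_zero_of_lyapunovKrasovskii (P := L P) (R := L R) (S := L S) (hLs P hP)
    (hLpos P hP) (hLs R hR) (hLpos R hR) (hLpos S hS) hh (half_pos hε) hd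
    (stronglyMeasurable_deriv e) (fun b => ?_) fun t ht => ?_
  · have hc : ContinuousOn (fun t => ‖L A (e t)‖ + ‖L A₁ (e (t - h))‖ + γm * ‖e t‖)
        (Icc h b) := by
      have h1 : ContinuousOn e (Icc h b) := hecont.mono fun t ht => by
        simp only [mem_Ici]; linarith [ht.1]
      have h2 : ContinuousOn (fun t => e (t - h)) (Icc h b) :=
        hecont.comp (by fun_prop) fun t ht => by simp only [mem_Ici]; linarith [ht.1]
      exact (((L A).continuous.comp_continuousOn h1).norm.add
        ((L A₁).continuous.comp_continuousOn h2).norm).add (continuousOn_const.mul h1.norm)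
    obtain ⟨C, hC⟩ := isCompact_Icc.exists_bound_of_continuousOn hc
    refine ⟨C, fun t ht => ?_⟩
    rw [(hede t (hh.trans_le ht.1)).deriv]
    refine le_trans ?_ ((le_abs_self _).trans (hC t ht))
    exact norm_add₃_le.trans (add_le_add_right (hκ _ _) _)
  · have hvt := (hede t (by linarith)).deriv
    set v := deriv e t
    have h1 := hQ (e t, v, e (t - h), κ (e t) t)
    have hv : A *ᵥ (e t).ofLp + A₁ *ᵥ (e (t - h)).ofLp + (κ (e t) t).ofLp - v.ofLp = 0 := by
      rw [hvt]
      simp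
    simp only [hv, dotProduct_zero, hdot] at h1
    have h2 : ‖κ (e t) t‖ ^ 2 ≤ γm ^ 2 * ‖e t‖ ^ 2 := by
      rw [← mul_pow]
      exact pow_le_pow_left₀ (norm_nonneg _) (hκ _ _) 2
    have h3 : ‖e t‖ ≤ ‖(e t, v, e (t - h), κ (e t) t)‖ := norm_fst_le (e t, v, e (t - h), κ (e t) t)
    have h4 : ‖v‖ ≤ ‖(e t, v, e (t - h), κ (e t) t)‖ :=
      (norm_fst_le (v, e (t - h), κ (e t) t)).trans (norm_snd_le (e t, v, e (t - h), κ (e t) t))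
    have h5 := pow_le_pow_left₀ (norm_nonneg _) h3 2
    have h6 := pow_le_pow_left₀ (norm_nonneg _) h4 2
    simp only [hL, WithLp.ofLp_sub]
    nlinarith
end

section
/- Let n ≥ 1 and L = (l₁,…,lₙ) ∈ ℝⁿ. Let A ∈ ℝ^{n×n} be the single nilpotent Jordan block with eigenvalue 0, C = (1,0,…,0) ∈ ℝ^{1×n}, and let eₙ ∈ ℝⁿ be the n-th standard basis vector. Then there exists v ∈ ℝⁿ with v ≠ 0 such that A·v − v₁·L + lₙ·v₁·eₙ = 0 (equivalently, the matrix A − LC + lₙ·eₙC is singular). Consequently, the constant function ε(τ) ≡ v is a nonzero equilibrium of the perturbed linear delay equation ε'(τ) = A·ε(τ) − L·(Cε(τ−1)) + w(τ) with delay-free perturbation w(τ) = lₙ·(Cε(τ))·eₙ, which satisfies ‖w(τ)‖ ≤ |lₙ|·‖ε(τ)‖; hence this delay system admits a bounded perturbation of linear gain |lₙ| that destroys asymptotic stability. -/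
theorem Matrix.mulVec_shift_apply_of_lt {n : ℕ} {A : Matrix (Fin n) (Fin n) ℝ}
    (hA : ∀ i j : Fin n, A i j = if (j : ℕ) = (i : ℕ) + 1 then 1 else 0)
    (v : Fin n → ℝ) (i : Fin n) (hi : (i : ℕ) + 1 < n) :
    A.mulVec v i = v ⟨i + 1, hi⟩ := by
  rw [Matrix.mulVec, dotProduct, Finset.sum_eq_single ⟨i + 1, hi⟩]
  · simp [hA]
  · intro j _ hj
    rw [hA, if_neg fun h => hj (Fin.ext h), zero_mul]
  · simp

theorem Matrix.mulVec_shift_apply_of_le {n : ℕ} {A : Matrix (Fin n) (Fin n) ℝ}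
    (hA : ∀ i j : Fin n, A i j = if (j : ℕ) = (i : ℕ) + 1 then 1 else 0)
    (v : Fin n → ℝ) (i : Fin n) (hi : n ≤ (i : ℕ) + 1) :
    A.mulVec v i = 0 := by
  rw [Matrix.mulVec, dotProduct]
  refine Finset.sum_eq_zero fun j _ => ?_
  rw [hA, if_neg (by omega), zero_mul]

/-- for the nilpotent Jordan block `A`, `C = (1,0,…,0)` and any gain
`L ∈ ℝⁿ`, the matrix `A − LC + lₙ·eₙC` is singular: there is `v ≠ 0` with
`A·v − v₁·L + lₙ·v₁·eₙ = 0`.  Consequently the constant function `ε ≡ v` is a nonzero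
equilibrium of `ε'(τ) = A ε(τ) − L·(Cε(τ−1)) + w(τ)` with delay-free perturbation
`w(τ) = lₙ·(Cε(τ))·eₙ`, which satisfies `‖w(τ)‖ ≤ |lₙ|·‖ε(τ)‖`. -/
theorem gain_margin_upper_bound_ln
    (n : ℕ) (hn : 1 ≤ n)
    (L : EuclideanSpace ℝ (Fin n))
    (A : Matrix (Fin n) (Fin n) ℝ)
    (hA : ∀ i j : Fin n, A i j = if (j : ℕ) = (i : ℕ) + 1 then 1 else 0) :
    ∃ v : EuclideanSpace ℝ (Fin n), v ≠ 0 ∧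
      (WithLp.equiv 2 (Fin n → ℝ)).symm (A.mulVec v) - v ⟨0, hn⟩ • L
        + (L ⟨n - 1, by omega⟩ * v ⟨0, hn⟩) • EuclideanSpace.single ⟨n - 1, by omega⟩ (1 : ℝ)
        = 0 ∧
      (∀ τ : ℝ, HasDerivAt (fun _ : ℝ => v)
        ((WithLp.equiv 2 (Fin n → ℝ)).symm (A.mulVec v) - v ⟨0, hn⟩ • L
          + (L ⟨n - 1, by omega⟩ * v ⟨0, hn⟩) •
              EuclideanSpace.single ⟨n - 1, by omega⟩ (1 : ℝ)) τ) ∧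
      ‖(L ⟨n - 1, by omega⟩ * v ⟨0, hn⟩) •
          EuclideanSpace.single (⟨n - 1, by omega⟩ : Fin n) (1 : ℝ)‖
        ≤ |L ⟨n - 1, by omega⟩| * ‖v‖ := by
  obtain ⟨v, hv_zero, hv_succ⟩ : ∃ v : EuclideanSpace ℝ (Fin n), v ⟨0, hn⟩ = 1 ∧
      ∀ (i : Fin n) (hi : (i : ℕ) + 1 < n), v ⟨i + 1, hi⟩ = L i :=
    ⟨WithLp.toLp 2 fun i => if (i : ℕ) = 0 then 1 else L ⟨i - 1, by omega⟩, by simp, by simp⟩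
  have heq : (WithLp.equiv 2 (Fin n → ℝ)).symm (A.mulVec v) - v ⟨0, hn⟩ • L
      + (L ⟨n - 1, by omega⟩ * v ⟨0, hn⟩) •
          EuclideanSpace.single ⟨n - 1, by omega⟩ (1 : ℝ) = 0 := by
    ext i
    by_cases hi : (i : ℕ) + 1 < n
    · have hne : i ≠ ⟨n - 1, by omega⟩ := fun h => by
        have := congrArg Fin.val h
        simp only at this
        omega
      simp [Matrix.mulVec_shift_apply_of_lt hA v i hi, hv_succ i hi, hv_zero, hne]
    · obtain rfl : i = ⟨n - 1, Nat.sub_one_lt_of_le hn le_rfl⟩ := Fin.ext (by simp only; omega)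
      simp [Matrix.mulVec_shift_apply_of_le hA v _ (not_lt.mp hi), hv_zero]
  refine ⟨v, ?_, heq, fun τ => ?_, ?_⟩
  · rintro rfl
    simp at hv_zero
  · rw [heq]
    exact hasDerivAt_const τ v
  · rw [norm_smul, PiLp.norm_single, norm_one, mul_one, norm_mul, Real.norm_eq_abs]
    exact mul_le_mul_of_nonneg_left (PiLp.norm_apply_le v _) (abs_nonneg _)
end
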